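/- arXiv:1602.05379 — 3 statements merged into one kernel-verified Lean document; each statement's English description precedes it below -/
import Mathlib

section
/- Let (A, m) be a noetherian local ring with residue field k = A/m and finite global dimension. Then dim_k(m/m²) = dim A, i.e. A is a regular local ring. -/
/-!
STATEMENT 13: Let (A, m) be a noetherian local ring with residue field k = A/m and finite
global dimension. Then dim_k(m/m²) = dim A, i.e. A is a regular local ring.
-/

open CategoryTheory Limits IsLocalRing

universe u

/-- The global dimension of a commutative ring: the supremum (in `ℕ∞`) over all pairs of
modules `M, N` of the integers `p` with `Ext_A^p(M, N) ≠ 0`. -/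
noncomputable def gldh (A : Type u) [CommRing A] : ℕ∞ :=
  sSup {n : ℕ∞ | ∃ (p : ℕ) (M N : ModuleCat.{u} A),
    n = (p : ℕ∞) ∧ ¬ IsZero (((Ext A (ModuleCat.{u} A) p).obj (Opposite.op M)).obj N)}

theorem hasPD_of_gldh (A : Type u) [CommRing A] (hgl : gldh A ≠ ⊤) (M : ModuleCat.{u} A) :
    ∃ n : ℕ, HasProjectiveDimensionLT M n := by
  obtain ⟨n, hn⟩ := ENat.ne_top_iff_exists.mp hgl
  refine ⟨n + 1, HasProjectiveDimensionLT.mk ?_⟩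
  intro i hi Y e
  obtain ⟨i, rfl⟩ : ∃ j, i = j + 1 := ⟨i - 1, by omega⟩
  let P : ProjectiveResolution M := projectiveResolution M
  obtain ⟨f, hf, rfl⟩ := P.extMk_surjective e (i + 2) rfl
  rw [P.extMk_eq_zero_iff f (i + 2) rfl hf i rfl]
  have hz : IsZero (((Ext A (ModuleCat.{u} A) (i + 1)).obj (Opposite.op M)).obj Y) := by
    by_contra h
    have : ((i + 1 : ℕ) : ℕ∞) ≤ gldh A := le_sSup ⟨i + 1, M, Y, rfl, h⟩
    rw [← hn] at this
    have := Nat.cast_le.mp this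
    omega
  have hz2 := hz.of_iso (P.isoExt (R := A) (i + 1) Y).symm
  rw [← HomologicalComplex.exactAt_iff_isZero_homology,
    HomologicalComplex.exactAt_iff' _ i (i + 1) (i + 2) (by simp) (by simp),
    ShortComplex.moduleCat_exact_iff] at hz2
  obtain ⟨g, hg⟩ := hz2 f hf
  exact ⟨g, hg⟩

theorem free_of_socle {A : Type u} [CommRing A] [IsNoetherianRing A] [IsLocalRing A]
    (a : A) (ha : a ≠ 0) (hm : ∀ x ∈ maximalIdeal A, a * x = 0) (n : ℕ)
    (M : Type u) [AddCommGroup M] [Module A M] [Module.Finite A M]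
    (hM : HasProjectiveDimensionLT (ModuleCat.of A M) (n + 1)) : Module.Free A M := by
  induction n generalizing M with
  | zero =>
    have : Projective (ModuleCat.of A M) := projective_iff_hasProjectiveDimensionLT_one.mpr hM
    have : Module.Projective A M := (IsProjective.iff_projective M).mpr this
    exact Module.free_of_flat_of_isLocalRing
  | succ n ih =>
    let b := Module.finBasis (ResidueField A) (TensorProduct A (ResidueField A) M)
    have hs : Function.Surjective (TensorProduct.mk A (ResidueField A) M 1) :=
      TensorProduct.mk_surjective A M (ResidueField A) Ideal.Quotient.mk_surjective
    choose v hv using fun i => hs (b i)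
    let f := Fintype.linearCombination A v
    have hf : Function.Surjective f := by
      rw [← LinearMap.range_eq_top, Fintype.range_linearCombination]
      exact IsLocalRing.span_eq_top_of_tmul_eq_basis v b hv
    have hker : ∀ w ∈ LinearMap.ker f, ∀ i, w i ∈ maximalIdeal A := by
      intro w hw i
      have h1 : ∑ i, residue A (w i) • b i = 0 := by
        have := congrArg (TensorProduct.mk A (ResidueField A) M 1) (LinearMap.mem_ker.mp hw)
        simp only [f, Fintype.linearCombination_apply, map_sum, map_smul, hv, map_zero] at this
        rw [← this]
        refine Finset.sum_congr rfl fun i _ => ?_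
        exact algebraMap_smul (ResidueField A) (w i) (b i)
      have h2 := Fintype.linearIndependent_iff.mp b.linearIndependent _ h1 i
      exact Ideal.Quotient.eq_zero_iff_mem.mp h2
    have hS := LinearMap.shortExact_shortComplexKer hf
    have hK : HasProjectiveDimensionLT (ModuleCat.of A (LinearMap.ker f)) (n + 1) := by
      have hP : Projective (ModuleCat.of A (Fin (Module.finrank (ResidueField A) (TensorProduct A (ResidueField A) M)) → A)) :=
        (IsProjective.iff_projective _).mp inferInstance
      exact (hS.hasProjectiveDimensionLT_X₃_iff n hP).mp hM
    have hfree := ih (LinearMap.ker f) hK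
    have hinj : LinearMap.ker f = ⊥ := by
      by_contra hne
      have : Nontrivial (LinearMap.ker f) := Submodule.nontrivial_iff_ne_bot.mpr hne
      have hmem : a ∈ Module.annihilator A (LinearMap.ker f) := by
        rw [Module.mem_annihilator]
        rintro ⟨w, hw⟩
        ext i
        exact hm _ (hker w hw i)
      rw [Module.annihilator_eq_bot.mpr inferInstance] at hmem
      exact ha hmem
    exact Module.Free.of_equiv (LinearEquiv.ofBijective f ⟨LinearMap.ker_eq_bot.mp hinj, hf⟩)

theorem pd_ses {B : Type u} [CommRing B] (n : ℕ) {K F M : Type u} [AddCommGroup K] [AddCommGroup F]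
    [AddCommGroup M] [Module B K] [Module B F] [Module B M] [Module.Free B F]
    (i : K →ₗ[B] F) (f : F →ₗ[B] M) (hi : Function.Injective i) (hex : Function.Exact i f)
    (hf : Function.Surjective f) (hK : HasProjectiveDimensionLT (ModuleCat.of B K) (n + 1)) :
    HasProjectiveDimensionLT (ModuleCat.of B M) (n + 1 + 1) := by
  let S : ShortComplex (ModuleCat.{u} B) :=
      { f := ModuleCat.ofHom i
        g := ModuleCat.ofHom f
        zero := by
          ext y
          exact hex.apply_apply_eq_zero y }
  have hS' : S.ShortExact :=
      { exact := (ShortComplex.ShortExact.moduleCat_exact_iff_function_exact _).mpr hex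
        mono_f := (ModuleCat.mono_iff_injective _).mpr hi
        epi_g := (ModuleCat.epi_iff_surjective _).mpr hf }
  have hP : Projective S.X₂ :=
        (IsProjective.iff_projective (R := B) F).mp inferInstance
  exact (hS'.hasProjectiveDimensionLT_X₃_iff n hP).mpr hK

theorem pd_quot {A : Type u} [CommRing A] [IsNoetherianRing A] [IsLocalRing A]
    (x : A) (hx : IsSMulRegular A x) (n : ℕ)
    (M : Type u) [AddCommGroup M] [Module A M] [Module.Finite A M] (hxM : IsSMulRegular M x)
    (hM : HasProjectiveDimensionLT (ModuleCat.of A M) (n + 1)) :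
    HasProjectiveDimensionLT (ModuleCat.of (A ⧸ Ideal.span {x}) (QuotSMulTop x M)) (n + 1) := by
  induction n generalizing M with
  | zero =>
    have : Projective (ModuleCat.of A M) := projective_iff_hasProjectiveDimensionLT_one.mpr hM
    have : Module.Projective A M := (IsProjective.iff_projective M).mpr this
    have : Module.Free A M := Module.free_of_flat_of_isLocalRing
    have : Projective (ModuleCat.of (A ⧸ Ideal.span {x}) (QuotSMulTop x M)) :=
      (IsProjective.iff_projective _).mp inferInstance
    exact projective_iff_hasProjectiveDimensionLT_one.mp this
  | succ n ih =>
    obtain ⟨F, _, _, _, _, f, hf⟩ := Module.exists_finite_presentation A M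
    have hS := LinearMap.shortExact_shortComplexKer hf
    have hK : HasProjectiveDimensionLT (ModuleCat.of A (LinearMap.ker f)) (n + 1) := by
      have hP : Projective (ModuleCat.of A F) :=
        (IsProjective.iff_projective _).mp inferInstance
      exact (hS.hasProjectiveDimensionLT_X₃_iff n hP).mp hM
    have hxF : IsSMulRegular F x := Module.Flat.isSMulRegular_of_isRegular
      ((Commute.isRegular_iff (Commute.all x)).mpr (isLeftRegular_iff.mpr hx))
    have hxK : IsSMulRegular (LinearMap.ker f) x := hxF.submodule _ _
    have hK' := ih (LinearMap.ker f) hxK hK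
    have hsurj : Function.Surjective (algebraMap A (A ⧸ Ideal.span {x})) :=
      Ideal.Quotient.mk_surjective
    let i' := (QuotSMulTop.map x (LinearMap.ker f).subtype).extendScalarsOfSurjective hsurj
    let f' := (QuotSMulTop.map x f).extendScalarsOfSurjective hsurj
    have hex : Function.Exact (LinearMap.ker f).subtype f := LinearMap.exact_subtype_ker_map f
    have hex' : Function.Exact i' f' := QuotSMulTop.map_exact x hex hf
    have hinj : Function.Injective i' := by
      have h0 : Function.Exact (0 : PUnit →ₗ[A] LinearMap.ker f) (LinearMap.ker f).subtype := by
        rw [LinearMap.exact_zero_iff_injective]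
        exact Subtype.val_injective
      have := QuotSMulTop.map_first_exact_on_four_term_exact_of_isSMulRegular_last h0 hex hxM
      have h2 : QuotSMulTop.map x (0 : PUnit →ₗ[A] LinearMap.ker f) = 0 := map_zero _
      rw [h2, LinearMap.exact_zero_iff_injective] at this
      exact this
    have hsf : Function.Surjective f' := QuotSMulTop.map_surjective x hf
    exact pd_ses n i' f' hinj hex' hsf hK'

open Pointwise in
theorem retract_step {A : Type u} [CommRing A] [IsNoetherianRing A] [IsLocalRing A]
    (x : A) (hxm : x ∈ maximalIdeal A) (hx2 : x ∉ maximalIdeal A ^ 2)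
    [IsLocalRing (A ⧸ Ideal.span {x})] :
    Nonempty (Retract
      (ModuleCat.of (A ⧸ Ideal.span {x}) (ResidueField (A ⧸ Ideal.span {x})))
      (ModuleCat.of (A ⧸ Ideal.span {x}) (QuotSMulTop x (maximalIdeal A)))) := by
  let B := A ⧸ Ideal.span {x}
  have hsurj : Function.Surjective (algebraMap A B) := Ideal.Quotient.mk_surjective
  let xm : maximalIdeal A := ⟨x, hxm⟩
  have hloc : IsLocalHom (Ideal.Quotient.mk (Ideal.span {x})) :=
    .of_surjective _ Ideal.Quotient.mk_surjective
  -- the inclusion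
  let q : QuotSMulTop x (maximalIdeal A) := Submodule.Quotient.mk xm
  have hj : maximalIdeal B ≤ LinearMap.ker (LinearMap.toSpanSingleton B _ q) := by
    intro z hz
    obtain ⟨w, rfl⟩ := Ideal.Quotient.mk_surjective z
    have hw : w ∈ maximalIdeal A := by
      rw [mem_maximalIdeal, mem_nonunits_iff] at hz ⊢
      exact fun h => hz (h.map _)
    rw [LinearMap.mem_ker, LinearMap.toSpanSingleton_apply]
    change (Submodule.Quotient.mk (w • xm) : QuotSMulTop x (maximalIdeal A)) = 0
    rw [Submodule.Quotient.mk_eq_zero]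
    have : w • xm = x • (⟨w, hw⟩ : maximalIdeal A) := by
      ext
      simp [xm, mul_comm]
    rw [this]
    exact Submodule.smul_mem_pointwise_smul _ _ _ trivial
  let j : ResidueField B →ₗ[B] QuotSMulTop x (maximalIdeal A) :=
    Submodule.liftQ (maximalIdeal B) (LinearMap.toSpanSingleton B _ q) hj
  -- the functional
  have hc : (maximalIdeal A).toCotangent xm ≠ 0 := by
    rw [Ne, Ideal.toCotangent_eq_zero]
    exact hx2
  obtain ⟨φ, hφ⟩ : ∃ φ : CotangentSpace A →ₗ[ResidueField A] ResidueField A,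
      φ ((maximalIdeal A).toCotangent xm) = 1 :=
    Module.Projective.exists_dual_eq_one _ hc
  let r : ResidueField A →ₗ[A] ResidueField B :=
    { toFun := ResidueField.map (Ideal.Quotient.mk (Ideal.span {x}))
      map_add' := map_add _
      map_smul' := by
        intro a y
        obtain ⟨y, rfl⟩ := residue_surjective y
        rfl }
  let ψ : maximalIdeal A →ₗ[A] ResidueField B :=
    r ∘ₗ (φ.restrictScalars A) ∘ₗ (maximalIdeal A).toCotangent
  have hψ : x • (⊤ : Submodule A (maximalIdeal A)) ≤ LinearMap.ker ψ := by
    intro z hz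
    obtain ⟨y, _, rfl⟩ := (Submodule.mem_smul_pointwise_iff_exists _ _ _).mp hz
    rw [LinearMap.mem_ker, map_smul]
    obtain ⟨t, ht⟩ := residue_surjective (ψ y)
    rw [← ht]
    change residue B (Ideal.Quotient.mk _ x * t) = 0
    rw [Ideal.Quotient.eq_zero_iff_mem.mpr (Ideal.mem_span_singleton_self x)]
    simp
  let p : QuotSMulTop x (maximalIdeal A) →ₗ[B] ResidueField B :=
    (Submodule.liftQ _ ψ hψ).extendScalarsOfSurjective hsurj
  refine ⟨⟨ModuleCat.ofHom j, ModuleCat.ofHom p, ?_⟩⟩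
  rw [← ModuleCat.ofHom_comp, ← ModuleCat.ofHom_id]
  congr 1
  have hp : p (j 1) = 1 := by
    change p ((1 : B) • q) = 1
    rw [one_smul]
    change ResidueField.map (Ideal.Quotient.mk (Ideal.span {x})) (φ ((maximalIdeal A).toCotangent xm)) = 1
    rw [hφ, map_one]
  ext z
  obtain ⟨z, rfl⟩ := residue_surjective z
  have : residue B z = z • (1 : ResidueField B) := by
    rw [← ResidueField.algebraMap_eq, Algebra.algebraMap_eq_smul_one]
  change p (j (residue B z)) = residue B z
  rw [this, map_smul, map_smul, hp]

theorem spanFinrank_le_quot {A : Type u} [CommRing A] [IsNoetherianRing A]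
    (I : Ideal A) (x : A) (hx : x ∈ I) :
    I.spanFinrank ≤ (I.map (Ideal.Quotient.mk (Ideal.span {x}))).spanFinrank + 1 := by
  set J := I.map (Ideal.Quotient.mk (Ideal.span {x})) with hJ
  have hJfg : J.FG := Ideal.FG.map (IsNoetherian.noetherian I) _
  let g := Function.surjInv (Ideal.Quotient.mk_surjective (I := Ideal.span {x}))
  have hg : ∀ z, Ideal.Quotient.mk (Ideal.span {x}) (g z) = z :=
    Function.surjInv_eq Ideal.Quotient.mk_surjective
  have hfin : (g '' J.generators).Finite := (Submodule.FG.finite_generators hJfg).image g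
  have hI : I = Ideal.span (insert x (g '' J.generators)) := by
    have h1 : I = J.comap (Ideal.Quotient.mk (Ideal.span {x})) := by
      rw [hJ, Ideal.comap_map_of_surjective' _ Ideal.Quotient.mk_surjective, Ideal.mk_ker]
      exact (sup_eq_left.mpr ((Ideal.span_singleton_le_iff_mem _).mpr hx)).symm
    have h2 : J = (Ideal.span (g '' J.generators)).map (Ideal.Quotient.mk (Ideal.span {x})) := by
      rw [Ideal.map_span, ← Set.image_comp]
      have : (⇑(Ideal.Quotient.mk (Ideal.span {x})) ∘ g) = id := funext hg
      rw [this, Set.image_id]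
      exact J.span_generators.symm
    rw [Ideal.span_insert]
    conv_lhs => rw [h1, h2]
    rw [Ideal.comap_map_of_surjective' _ Ideal.Quotient.mk_surjective, Ideal.mk_ker, sup_comm]
  calc I.spanFinrank ≤ (insert x (g '' J.generators)).ncard := by
        conv_lhs => rw [hI]
        exact Submodule.spanFinrank_span_le_ncard_of_finite (hfin.insert x)
    _ ≤ (g '' J.generators).ncard + 1 := Set.ncard_insert_le _ _
    _ ≤ J.generators.ncard + 1 :=
        Nat.add_le_add_right (Set.ncard_image_le (Submodule.FG.finite_generators hJfg)) 1
    _ = _ := by rw [Submodule.FG.generators_ncard hJfg]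

theorem exists_regular_elt {A : Type u} [CommRing A] [IsNoetherianRing A] [IsLocalRing A]
    (hne : maximalIdeal A ≠ ⊥)
    (n : ℕ) (hpd : HasProjectiveDimensionLT (ModuleCat.of A (ResidueField A)) n) :
    ∃ x ∈ maximalIdeal A, x ∉ maximalIdeal A ^ 2 ∧ IsSMulRegular A x := by
  by_contra! hcon
  have hsub : ((maximalIdeal A : Ideal A) : Set A) ⊆
      ⋃ p ∈ insert (maximalIdeal A ^ 2) (associatedPrimes A A), ((id p : Ideal A) : Set A) := by
    intro x hx
    by_cases h2 : x ∈ maximalIdeal A ^ 2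
    · exact Set.mem_biUnion (Set.mem_insert _ _) h2
    · have h3 : x ∈ ⋃ p ∈ associatedPrimes A A, (p : Set A) := by
        rw [biUnion_associatedPrimes_eq_compl_regular]
        exact hcon x hx h2
      obtain ⟨p, hp, hxp⟩ := Set.mem_iUnion₂.mp h3
      exact Set.mem_biUnion (Set.mem_insert_of_mem _ hp) hxp
  rw [Ideal.subset_union_prime_finite ((associatedPrimes.finite A A).insert _)
    (maximalIdeal A ^ 2) (maximalIdeal A ^ 2)] at hsub
  · obtain ⟨p, hp, hle⟩ := hsub
    rcases hp with rfl | hp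
    · apply hne
      refine Submodule.eq_bot_of_le_smul_of_le_jacobson_bot (maximalIdeal A) _
        (IsNoetherian.noetherian _) ?_ (maximalIdeal_le_jacobson _)
      simpa [pow_two] using hle
    · have hpm : p = maximalIdeal A :=
        le_antisymm (le_maximalIdeal hp.isPrime.ne_top) hle
      subst hpm
      obtain ⟨_, a, ha⟩ := isAssociatedPrime_iff.mp hp
      have ha0 : a ≠ 0 := by
        rintro rfl
        have : (1 : A) ∈ maximalIdeal A := by
          rw [ha, Submodule.mem_colon_singleton]
          simp
        exact (maximalIdeal.isMaximal A).ne_top ((Ideal.eq_top_iff_one _).mpr this)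
      have hfree : Module.Free A (ResidueField A) := by
        refine free_of_socle a ha0 ?_ n (ResidueField A)
          (hasProjectiveDimensionLT_of_ge _ n (n + 1) (by omega))
        intro x hx
        rw [ha, Submodule.mem_colon_singleton] at hx
        simpa [mul_comm] using hx
      apply hne
      have := Module.annihilator_eq_bot.mpr (inferInstance : FaithfulSMul A (ResidueField A))
      rw [← this]
      exact (Ideal.annihilator_quotient (I := maximalIdeal A)).symm
  · intro i hi h1 _
    exact (hi.resolve_left h1).isPrime

theorem regular_aux (d : ℕ) : ∀ (A : Type u) [CommRing A] [IsNoetherianRing A] [IsLocalRing A]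
    (_ : ringKrullDim A = d) (n : ℕ)
    (_ : HasProjectiveDimensionLT (ModuleCat.of A (ResidueField A)) n),
    ((maximalIdeal A).spanFinrank : WithBot ℕ∞) ≤ ringKrullDim A := by
  induction d with
  | zero =>
    intro A _ _ _ hd n hpd
    by_cases hne : maximalIdeal A = ⊥
    · simp [hne, hd]
    obtain ⟨x, hxm, hx2, hx⟩ := exists_regular_elt hne n hpd
    have h1 := ringKrullDim_quotient_span_singleton_succ_eq_ringKrullDim hx hxm
    have : Nontrivial (A ⧸ Ideal.span {x}) := Ideal.Quotient.nontrivial_iff.mpr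
      (fun h => (maximalIdeal.isMaximal A).ne_top
        (top_le_iff.mp (h ▸ (Ideal.span_singleton_le_iff_mem _).mpr hxm)))
    have h2 := ringKrullDim_nonneg_of_nontrivial (R := A ⧸ Ideal.span {x})
    rw [hd] at h1
    have : (1 : WithBot ℕ∞) ≤ 0 := by
      calc (1 : WithBot ℕ∞) = 0 + 1 := by simp
        _ ≤ _ := add_le_add_left h2 1
        _ = _ := h1
    exact absurd this (by decide)
  | succ d ih =>
    intro A _ _ _ hd n hpd
    by_cases hne : maximalIdeal A = ⊥
    · rw [hne, hd]
      simp only [Submodule.spanFinrank_bot]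
      exact_mod_cast Nat.zero_le (d + 1)
    obtain ⟨x, hxm, hx2, hx⟩ := exists_regular_elt hne n hpd
    have h1 := ringKrullDim_quotient_span_singleton_succ_eq_ringKrullDim hx hxm
    have : Nontrivial (A ⧸ Ideal.span {x}) := Ideal.Quotient.nontrivial_iff.mpr
      (fun h => (maximalIdeal.isMaximal A).ne_top
        (top_le_iff.mp (h ▸ (Ideal.span_singleton_le_iff_mem _).mpr hxm)))
    have hloc : IsLocalRing (A ⧸ Ideal.span {x}) :=
      .of_surjective' (Ideal.Quotient.mk _) Ideal.Quotient.mk_surjective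
    have hd' : ringKrullDim (A ⧸ Ideal.span {x}) = d := by
      rw [hd] at h1
      have h1' : ringKrullDim (A ⧸ Ideal.span {x}) + 1 = (d : WithBot ℕ∞) + 1 := by
        rw [h1]; push_cast; rfl
      exact ENat.WithBot.add_one_cancel.mp h1'
    have hm : HasProjectiveDimensionLT (ModuleCat.of A (maximalIdeal A)) (n + 1) := by
      let q : A →ₗ[A] ResidueField A := Submodule.mkQ (maximalIdeal A)
      have hS := LinearMap.shortExact_shortComplexKer (f := q) (Submodule.mkQ_surjective _)
      have hP : Projective (ModuleCat.of A A) :=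
        (IsProjective.iff_projective _).mp inferInstance
      have h3 := hasProjectiveDimensionLT_of_ge (ModuleCat.of A (ResidueField A)) n (n + 2)
        (by omega)
      have := (hS.hasProjectiveDimensionLT_X₃_iff n hP).mp h3
      have hk : LinearMap.ker q = maximalIdeal A := Submodule.ker_mkQ _
      exact hasProjectiveDimensionLT_of_iso (LinearEquiv.ofEq _ _ hk).toModuleIso _
    have hm' := pd_quot x hx n (maximalIdeal A) (hx.submodule _ _) hm
    obtain ⟨r⟩ := retract_step x hxm hx2
    have hk' := r.hasProjectiveDimensionLT (n + 1)
    have h4 := ih (A ⧸ Ideal.span {x}) hd' (n + 1) hk'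
    have h5 := spanFinrank_le_quot (maximalIdeal A) x hxm
    have hmap : (maximalIdeal A).map (Ideal.Quotient.mk (Ideal.span {x})) =
        maximalIdeal (A ⧸ Ideal.span {x}) :=
      IsLocalRing.map_maximalIdeal_of_surjective _ Ideal.Quotient.mk_surjective
    rw [hmap] at h5
    rw [← h1]
    calc ((maximalIdeal A).spanFinrank : WithBot ℕ∞)
        ≤ (((maximalIdeal (A ⧸ Ideal.span {x})).spanFinrank + 1 : ℕ) : WithBot ℕ∞) := by
          exact_mod_cast h5
      _ = ((maximalIdeal (A ⧸ Ideal.span {x})).spanFinrank : WithBot ℕ∞) + 1 := by push_cast; rfl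
      _ ≤ _ := add_le_add_left h4 1

theorem regular_of_finite_gldh
    (A : Type u) [CommRing A] [IsNoetherianRing A] [IsLocalRing A]
    (hgl : gldh A ≠ ⊤) :
    ringKrullDim A =
      (Module.finrank (ResidueField A) (CotangentSpace A) : WithBot ℕ∞) := by
  obtain ⟨n, hn⟩ := hasPD_of_gldh A hgl (ModuleCat.of A (ResidueField A))
  obtain ⟨d, hd⟩ : ∃ d : ℕ, ringKrullDim A = d := by
    have h1 := ringKrullDim_ne_top (R := A)
    have h2 := ringKrullDim_ne_bot (R := A)
    revert h1 h2
    generalize ringKrullDim A = e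
    intro h1 h2
    induction e with
    | bot => exact absurd rfl h2
    | coe e =>
      induction e with
      | top => exact absurd rfl h1
      | coe d => exact ⟨d, rfl⟩
  have := regular_aux d A hd n hn
  have := IsRegularLocalRing.of_spanFinrank_maximalIdeal_le A this
  exact ((IsRegularLocalRing.iff_finrank_cotangentSpace A).mp this).symm
end

section
/- Let (A, m) be a noetherian local ring of Krull dimension n with residue field k = A/m. Then the following are equivalent: (a) the global dimension of A is finite (in which case gldh A = n); (b) dim_k(m/m²) = n; (c) m can be generated by n elements; (d) the associated graded ring gr_m A is isomorphic as a graded k-algebra to the polynomial ring k[X_1, ..., X_n]. -/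
/-!
STATEMENT 14: Let (A, m) be a noetherian local ring of Krull dimension n with residue
field k = A/m. Then the following are equivalent:
(a) the global dimension of A is finite (in which case gldh A = n);
(b) dim_k(m/m²) = n;
(c) m can be generated by n elements;
(d) the associated graded ring gr_m A is isomorphic as a graded k-algebra to the
    polynomial ring k[X_1, ..., X_n].
-/

open CategoryTheory Limits IsLocalRing Polynomial

universe u

set_option maxHeartbeats 1000000
set_option synthInstance.maxHeartbeats 400000

/-- The associated graded ring (tangential cone) `gr_m A = ⊕_{i≥0} mⁱ/mⁱ⁺¹`, realized as
the quotient of the Rees algebra `A[mt] ⊆ A[t]` by the ideal generated by `m`. -/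
noncomputable def AssocGraded (A : Type u) [CommRing A] [IsLocalRing A] : Type u :=
  ↥(reesAlgebra (maximalIdeal A)) ⧸
    (Ideal.map (algebraMap A ↥(reesAlgebra (maximalIdeal A))) (maximalIdeal A))

noncomputable instance (A : Type u) [CommRing A] [IsLocalRing A] :
    CommRing (AssocGraded A) :=
  inferInstanceAs (CommRing (↥(reesAlgebra (maximalIdeal A)) ⧸
    (Ideal.map (algebraMap A ↥(reesAlgebra (maximalIdeal A))) (maximalIdeal A))))

/-- The associated graded ring is an algebra over the residue field `k = A/m`. -/
noncomputable instance (A : Type u) [CommRing A] [IsLocalRing A] :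
    Algebra (ResidueField A) (AssocGraded A) :=
  (Ideal.Quotient.lift (maximalIdeal A)
    ((Ideal.Quotient.mk _).comp (algebraMap A ↥(reesAlgebra (maximalIdeal A))) :
        A →+* AssocGraded A)
    (fun a ha => by
      show (Ideal.Quotient.mk _) _ = 0
      rw [Ideal.Quotient.eq_zero_iff_mem]
      exact Ideal.mem_map_of_mem _ ha)).toAlgebra

/-- The degree-`i` homogeneous component of the associated graded ring, as a `k`-submodule:
the classes of the elements of the Rees algebra concentrated in degree `i`. -/
noncomputable def AssocGraded.piece (A : Type u) [CommRing A] [IsLocalRing A] (i : ℕ) :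
    Submodule (ResidueField A) (AssocGraded A) :=
  Submodule.span (ResidueField A)
    (((Ideal.Quotient.mk _ :
        ↥(reesAlgebra (maximalIdeal A)) →+* AssocGraded A)) ''
      {x : ↥(reesAlgebra (maximalIdeal A)) | ∃ a : A, (x : A[X]) = Polynomial.monomial i a})



lemma devissage_aux (A : Type u) [CommRing A] [IsNoetherianRing A] [IsLocalRing A] (n : ℕ) (I : Ideal A)
    (h : ∀ q : PrimeSpectrum A, I ≤ q.1 → HasProjectiveDimensionLT (ModuleCat.of A (A ⧸ q.1)) (n + 1))
    (M : Type u) [AddCommGroup M] [Module A M] [hM : Module.Finite A M]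
    (hI : I ≤ Module.annihilator A M) :
    HasProjectiveDimensionLT (ModuleCat.of A M) (n + 1) := by
  induction hM using IsNoetherianRing.induction_on_isQuotientEquivQuotientPrime A with
  | subsingleton N =>
    have : HasProjectiveDimensionLT (ModuleCat.of A N) 0 :=
      Limits.IsZero.hasProjectiveDimensionLT_zero (ModuleCat.isZero_of_subsingleton _)
    exact hasProjectiveDimensionLT_of_ge _ 0 _ (Nat.zero_le _)
  | quotient N p f =>
    have := h p (by rw [f.annihilator_eq, Ideal.annihilator_quotient] at hI; exact hI)
    exact hasProjectiveDimensionLT_of_iso f.symm.toModuleIso _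
  | exact N₁ N₂ N₃ f g hf hg hfg h₁ h₃ =>
    let S : ShortComplex (ModuleCat.{u} A) := ShortComplex.mk (ModuleCat.ofHom f) (ModuleCat.ofHom g)
      (by ext x; simpa using hfg.apply_apply_eq_zero x)
    have hS : S.ShortExact := by
      refine ShortComplex.ShortExact.mk' ?_ ((ModuleCat.mono_iff_injective _).2 hf)
        ((ModuleCat.epi_iff_surjective _).2 hg)
      exact (ShortComplex.ShortExact.moduleCat_exact_iff_function_exact S).2 hfg
    exact hS.hasProjectiveDimensionLT_X₂ (n+1)
      (h₁ (hI.trans (f.annihilator_le_of_injective hf)))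
      (h₃ (hI.trans (g.annihilator_le_of_surjective hg)))

open scoped Pointwise in
lemma devissage (A : Type u) [CommRing A] [IsNoetherianRing A] [IsLocalRing A] (n : ℕ)
    (h : HasProjectiveDimensionLT (ModuleCat.of A (A ⧸ maximalIdeal A)) (n + 1))
    (M : Type u) [AddCommGroup M] [Module A M] [Module.Finite A M] :
    HasProjectiveDimensionLT (ModuleCat.of A M) (n + 1) := by
  refine devissage_aux A n ⊥ ?_ M bot_le
  suffices H : ∀ I : Ideal A, I.IsPrime → HasProjectiveDimensionLT (ModuleCat.of A (A ⧸ I)) (n + 1) from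
    fun q _ => H _ q.2
  intro I
  induction I using WellFoundedGT.induction with
  | ind p ih =>
  intro hp
  by_cases hpm : p = maximalIdeal A
  · rw [hpm]; exact h
  have hlt : p < maximalIdeal A := lt_of_le_of_ne (le_maximalIdeal hp.ne_top) hpm
  obtain ⟨x, hx, hxp⟩ := SetLike.exists_of_lt hlt
  have reg : IsSMulRegular (A ⧸ p) x := by
    intro a b hab
    simp only [Algebra.smul_def] at hab
    exact mul_left_cancel₀ (by simpa [Ideal.Quotient.eq_zero_iff_mem] using hxp) hab
  have key := ModuleCat.projectiveDimension_quotSMulTop_eq_succ_of_isSMulRegular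
    (ModuleCat.of A (A ⧸ p)) x reg hx
  have h1 : HasProjectiveDimensionLT (ModuleCat.of A (QuotSMulTop x (A ⧸ p))) (n + 1) := by
    refine devissage_aux A n (p ⊔ Ideal.span {x}) ?_ _ ?_
    · intro q hq
      exact ih _ (lt_of_le_of_ne (le_sup_left.trans hq) (fun h => hxp (by
        rw [h]; exact hq (Ideal.mem_sup_right (Ideal.mem_span_singleton_self x))))) q.2
    · refine sup_le ?_ ?_
      · refine le_trans ?_ (LinearMap.annihilator_le_of_surjective
          (Submodule.mkQ (x • (⊤ : Submodule A (A ⧸ p)))) (Submodule.mkQ_surjective _))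
        rw [Ideal.annihilator_quotient]
      · rw [Ideal.span_singleton_le_iff_mem]
        exact QuotSMulTop.mem_annihilator _ x
  rw [← projectiveDimension_lt_iff] at h1 ⊢
  refine lt_of_le_of_lt ?_ h1
  change _ ≤ projectiveDimension (ModuleCat.of A (QuotSMulTop x (ModuleCat.of A (A ⧸ p))))
  rw [key]
  generalize projectiveDimension (ModuleCat.of A (A ⧸ p)) = d
  induction d with
  | bot => exact bot_le
  | coe d => exact_mod_cast (le_self_add : d ≤ d + 1)


lemma hasInjDim_of_cyclic (A : Type u) [CommRing A] (n : ℕ) (N : ModuleCat.{u} A)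
    (h : ∀ I : Ideal A, Subsingleton (Abelian.Ext (ModuleCat.of A (A ⧸ I)) N (n + 1))) :
    HasInjectiveDimensionLT N (n + 1) := by
  induction n generalizing N with
  | zero =>
    rw [zero_add, ← injective_iff_hasInjectiveDimensionLT_one,
      ← Module.injective_iff_injective_object A N]
    apply Module.Baer.injective
    intro I g
    let S : ShortComplex (ModuleCat.{u} A) := ShortComplex.mk (ModuleCat.ofHom I.subtype)
      (ModuleCat.ofHom (Submodule.mkQ I)) (by ext x; exact (Submodule.Quotient.mk_eq_zero I).2 x.2)
    have hS : S.ShortExact := by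
      refine ShortComplex.ShortExact.mk' ?_ ((ModuleCat.mono_iff_injective _).2 I.subtype_injective)
        ((ModuleCat.epi_iff_surjective _).2 (Submodule.mkQ_surjective I))
      refine (ShortComplex.ShortExact.moduleCat_exact_iff_function_exact S).2 ?_
      exact LinearMap.exact_subtype_mkQ I
    have := h I
    obtain ⟨x₂, hx₂⟩ := Abelian.Ext.contravariant_sequence_exact₁ hS N
      (Abelian.Ext.mk₀ (ModuleCat.ofHom g)) (add_zero 1) (Subsingleton.elim (α := Abelian.Ext (ModuleCat.of A (A ⧸ I)) N (0+1)) _ _)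
    obtain ⟨f, rfl⟩ := (Abelian.Ext.mk₀_bijective _ _).2 x₂
    rw [Abelian.Ext.mk₀_comp_mk₀, (Abelian.Ext.mk₀_bijective _ _).1.eq_iff] at hx₂
    refine ⟨f.hom, fun x hx => ?_⟩
    have := congr($(hx₂).hom ⟨x, hx⟩)
    exact this
  | succ n ih =>
    obtain ⟨J⟩ := EnoughInjectives.presentation N
    let S : ShortComplex (ModuleCat.{u} A) := ShortComplex.mk J.f (cokernel.π J.f) (by simp)
    have hS : S.ShortExact := { exact := ShortComplex.exact_cokernel _ }
    have hJ : Injective S.X₂ := J.injective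
    rw [← hS.hasInjectiveDimensionLT_X₃_iff n hJ]
    apply ih
    intro I
    have := h I
    refine ⟨fun a b => ?_⟩
    suffices H : ∀ a : Abelian.Ext (ModuleCat.of A (A ⧸ I)) S.X₃ (n+1), a = 0 by rw [H a, H b]
    intro a
    obtain ⟨x, rfl⟩ := Abelian.Ext.covariant_sequence_exact₃ _ hS a rfl
      (Subsingleton.elim (α := Abelian.Ext (ModuleCat.of A (A ⧸ I)) N (n+1+1)) _ _)
    rw [x.eq_zero_of_hasInjectiveDimensionLT 1 (by omega), Abelian.Ext.zero_comp]

lemma projDim_of_cyclic (A : Type u) [CommRing A] (n : ℕ)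
    (h : ∀ I : Ideal A, HasProjectiveDimensionLT (ModuleCat.of A (A ⧸ I)) (n + 1))
    (M : ModuleCat.{u} A) : HasProjectiveDimensionLT M (n + 1) := by
  apply hasProjectiveDimensionLT_of_enoughInjectives
  intro Y
  have := hasInjDim_of_cyclic A n Y (fun I => by
    have := h I
    exact HasProjectiveDimensionLT.subsingleton _ (n+1) _ le_rfl _)
  exact HasInjectiveDimensionLT.subsingleton Y (n+1) _ le_rfl _

lemma isZero_ext_iff (A : Type u) [CommRing A] (M N : ModuleCat.{u} A) (p : ℕ) :
    IsZero (((Ext A (ModuleCat.{u} A) (p + 1)).obj (Opposite.op M)).obj N) ↔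
      Subsingleton (Abelian.Ext M N (p + 1)) := by
  let R := ProjectiveResolution.of M
  rw [(R.isoExt (R := A) (p + 1) N).isZero_iff, ← HomologicalComplex.exactAt_iff_isZero_homology,
    HomologicalComplex.exactAt_iff' _ p (p + 1) (p + 2) (by simp) (by simp),
    ShortComplex.moduleCat_exact_iff]
  constructor
  · intro H
    refine ⟨fun a b => ?_⟩
    suffices H : ∀ a : Abelian.Ext M N (p+1), a = 0 by rw [H a, H b]
    intro a
    obtain ⟨f, hf, rfl⟩ := R.extMk_surjective a (p + 2) rfl
    rw [R.extMk_eq_zero_iff f (p+2) rfl hf p rfl]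
    obtain ⟨g, hg⟩ := H f hf
    exact ⟨g, hg⟩
  · intro H f hf
    have : R.extMk f (p + 2) rfl hf = 0 := Subsingleton.elim _ _
    rw [R.extMk_eq_zero_iff f (p+2) rfl hf p rfl] at this
    obtain ⟨g, hg⟩ := this
    exact ⟨g, hg⟩

lemma gldh_le_iff (A : Type u) [CommRing A] (n : ℕ) :
    gldh A ≤ n ↔ ∀ M : ModuleCat.{u} A, HasProjectiveDimensionLT M (n + 1) := by
  unfold gldh
  rw [sSup_le_iff]
  constructor
  · intro h M
    apply hasProjectiveDimensionLT_of_enoughInjectives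
    intro Y
    rw [← isZero_ext_iff]
    by_contra hc
    have := h _ ⟨n + 1, M, Y, rfl, hc⟩
    have : n + 1 ≤ n := by exact_mod_cast this
    omega
  · rintro h _ ⟨p, M, N, rfl, hp⟩
    by_contra hc
    have hc : n < p := by
      rw [not_le] at hc
      exact_mod_cast hc
    obtain ⟨q, rfl⟩ : ∃ q, p = q + 1 := ⟨p - 1, by omega⟩
    apply hp
    rw [isZero_ext_iff]
    have := h M
    exact HasProjectiveDimensionLT.subsingleton _ (n+1) _ (by omega) _


open scoped Pointwise in
lemma projDim_quot (A : Type u) [CommRing A] (x : A) (hx : IsSMulRegular A x) (n : ℕ)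
    (M : Type u) [AddCommGroup M] [Module A M] (hM : IsSMulRegular M x)
    (h : HasProjectiveDimensionLT (ModuleCat.of A M) (n + 1)) :
    HasProjectiveDimensionLT (ModuleCat.of (A ⧸ Ideal.span {x}) (QuotSMulTop x M)) (n + 1) := by
  induction n generalizing M with
  | zero =>
    rw [zero_add, ← projective_iff_hasProjectiveDimensionLT_one, ← IsProjective.iff_projective] at h ⊢
    exact Module.Projective.of_equiv ((QuotSMulTop.equivQuotTensor x M).extendScalarsOfSurjective
      Ideal.Quotient.mk_surjective).symm
  | succ n ih =>
    let g : (M →₀ A) →ₗ[A] M := Finsupp.linearCombination A id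
    have hg : Function.Surjective g := Finsupp.linearCombination_id_surjective A M
    obtain ⟨K, _, _, ι, hι, e1⟩ : ∃ (K : Type u) (_ : AddCommGroup K) (_ : Module A K)
        (ι : K →ₗ[A] (M →₀ A)), Function.Injective ι ∧ Function.Exact ι g :=
      ⟨LinearMap.ker g, inferInstance, inferInstance, (LinearMap.ker g).subtype,
        (LinearMap.ker g).subtype_injective, LinearMap.exact_subtype_ker_map g⟩
    have hF : IsSMulRegular (M →₀ A) x := by
      intro a b hab
      ext i
      apply hx
      exact DFunLike.congr_fun hab i
    have hK : IsSMulRegular K x := hF.of_injective ι hι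
    have hKpd : HasProjectiveDimensionLT (ModuleCat.of A K) (n + 1) := by
      let S : ShortComplex (ModuleCat.{u} A) := ShortComplex.mk (ModuleCat.ofHom ι)
        (ModuleCat.ofHom g) (ModuleCat.hom_ext (LinearMap.ext fun y => e1.apply_apply_eq_zero y))
      have hS : S.ShortExact := by
        refine ShortComplex.ShortExact.mk' ?_ ((ModuleCat.mono_iff_injective _).2 hι)
          ((ModuleCat.epi_iff_surjective _).2 hg)
        exact (ShortComplex.ShortExact.moduleCat_exact_iff_function_exact S).2 e1
      have : Projective S.X₂ := by
        change Projective (ModuleCat.of A (M →₀ A))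
        rw [← IsProjective.iff_projective]
        infer_instance
      exact (hS.hasProjectiveDimensionLT_X₃_iff n this).1 h
    have hq := ih K hK hKpd
    have e2 : Function.Exact (QuotSMulTop.map x ι) (QuotSMulTop.map x g) :=
      QuotSMulTop.map_first_exact_on_four_term_exact_of_isSMulRegular_last (f₁ := ι) (f₂ := g)
        (f₃ := (0 : M →ₗ[A] PUnit.{u+1})) e1
        (by
          intro y
          simpa using hg y) (fun a b _ => Subsingleton.elim _ _)
    have e3 : Function.Exact (QuotSMulTop.map x (0 : PUnit.{u+1} →ₗ[A] K)) (QuotSMulTop.map x ι) :=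
      QuotSMulTop.map_first_exact_on_four_term_exact_of_isSMulRegular_last
        (f₃ := g) (by
          intro y
          simp only [Set.mem_range, LinearMap.zero_apply, exists_const]
          rw [← map_zero ι, hι.eq_iff, eq_comm]) e1 hM
    have inj : Function.Injective (QuotSMulTop.map x ι) := by
      rw [injective_iff_map_eq_zero]
      intro a ha
      obtain ⟨b, rfl⟩ := (e3 a).1 ha
      simp
    have surj : Function.Surjective (QuotSMulTop.map x g) := QuotSMulTop.map_surjective x hg
    let f' := (QuotSMulTop.map x ι).extendScalarsOfSurjective
      (Ideal.Quotient.mk_surjective (I := Ideal.span {x}))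
    let g' := (QuotSMulTop.map x g).extendScalarsOfSurjective
      (Ideal.Quotient.mk_surjective (I := Ideal.span {x}))
    let S : ShortComplex (ModuleCat.{u} (A ⧸ Ideal.span {x})) :=
      ShortComplex.mk (ModuleCat.ofHom f') (ModuleCat.ofHom g')
        (ModuleCat.hom_ext (LinearMap.ext fun y => e2.apply_apply_eq_zero y))
    have hS : S.ShortExact := by
      refine ShortComplex.ShortExact.mk' ?_ ((ModuleCat.mono_iff_injective _).2 inj)
        ((ModuleCat.epi_iff_surjective _).2 surj)
      exact (ShortComplex.ShortExact.moduleCat_exact_iff_function_exact S).2 e2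
    have : Projective S.X₂ := by
      change Projective (ModuleCat.of (A ⧸ Ideal.span {x}) (QuotSMulTop x (M →₀ A)))
      rw [← IsProjective.iff_projective]
      infer_instance
    exact (hS.hasProjectiveDimensionLT_X₃_iff n this).2 hq


section elementary

set_option linter.unusedSectionVars false
set_option linter.deprecated false

variable {A : Type u} [CommRing A] [IsLocalRing A]

lemma nontrivial_quot {x : A} (hx : x ∈ maximalIdeal A) : Nontrivial (A ⧸ Ideal.span {x}) := by
  apply Ideal.Quotient.nontrivial_iff.2
  intro h
  have h1 : Ideal.span {x} ≤ maximalIdeal A := by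
    rw [Ideal.span_singleton_le_iff_mem]
    exact hx
  rw [h] at h1
  exact (maximalIdeal.isMaximal A).ne_top (top_le_iff.1 h1)

lemma isLocal_quot {x : A} (hx : x ∈ maximalIdeal A) : IsLocalRing (A ⧸ Ideal.span {x}) := by
  have := nontrivial_quot hx
  exact IsLocalRing.of_surjective' (Ideal.Quotient.mk _) Ideal.Quotient.mk_surjective

lemma max_quot (x : A) [IsLocalRing (A ⧸ Ideal.span {x})] :
    maximalIdeal (A ⧸ Ideal.span {x}) = (maximalIdeal A).map (Ideal.Quotient.mk _) :=
  (IsLocalRing.map_maximalIdeal_of_surjective _ Ideal.Quotient.mk_surjective).symm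

lemma comap_max_quot (x : A) [IsLocalRing (A ⧸ Ideal.span {x})] (a : A) :
    Ideal.Quotient.mk (Ideal.span {x}) a ∈ maximalIdeal (A ⧸ Ideal.span {x}) ↔
      a ∈ maximalIdeal A := by
  have := IsLocalHom.of_surjective (Ideal.Quotient.mk (Ideal.span {x})) Ideal.Quotient.mk_surjective
  have := IsLocalRing.maximalIdeal_comap (Ideal.Quotient.mk (Ideal.span {x}))
  rw [← this, Ideal.mem_comap]

lemma gens_quot {n : ℕ} {x : A} [IsLocalRing (A ⧸ Ideal.span {x})] (g : Fin n → A)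
    (h : Ideal.span (Set.range (Fin.cons x g : Fin (n + 1) → A)) = maximalIdeal A) :
    Ideal.span (Set.range (Ideal.Quotient.mk (Ideal.span {x}) ∘ g)) =
      maximalIdeal (A ⧸ Ideal.span {x}) := by
  rw [max_quot, ← h, Fin.range_cons, Ideal.map_span, Set.image_insert_eq, Set.range_comp]
  have : Ideal.Quotient.mk (Ideal.span {x}) x = 0 := by
    rw [Ideal.Quotient.eq_zero_iff_mem]
    exact Ideal.mem_span_singleton_self x
  rw [this, Ideal.span_insert_zero]

lemma gens_lift {n : ℕ} {x : A} [IsLocalRing (A ⧸ Ideal.span {x})]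
    (g : Fin n → A)
    (h : Ideal.span (Set.range (Ideal.Quotient.mk (Ideal.span {x}) ∘ g)) =
      maximalIdeal (A ⧸ Ideal.span {x})) :
    Ideal.span (Set.range (Fin.cons x g : Fin (n + 1) → A)) = maximalIdeal A := by
  rw [Fin.range_cons, Ideal.span_insert]
  rw [Set.range_comp, ← Ideal.map_span] at h
  ext a
  rw [← comap_max_quot x, ← h, ← Ideal.mem_comap, Ideal.comap_map_of_surjective' _
    Ideal.Quotient.mk_surjective, Ideal.mk_ker, sup_comm]

lemma exchange {n : ℕ} (f : Fin (n + 1) → A) (hf : Ideal.span (Set.range f) = maximalIdeal A)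
    {x : A} (hx : x ∈ maximalIdeal A) (hx2 : x ∉ maximalIdeal A ^ 2) :
    ∃ g : Fin n → A, Ideal.span (Set.range (Fin.cons x g : Fin (n + 1) → A)) = maximalIdeal A := by
  have hfm : ∀ i, f i ∈ maximalIdeal A := fun i => hf ▸ Ideal.subset_span ⟨i, rfl⟩
  obtain ⟨c, hc⟩ := (Ideal.mem_span_range_iff_exists_fun).1 (hf ▸ hx)
  obtain ⟨i, hi⟩ : ∃ i, c i ∉ maximalIdeal A := by
    by_contra! hcon
    apply hx2
    rw [← hc, pow_two]
    exact Ideal.sum_mem _ fun i _ => Ideal.mul_mem_mul (hcon i) (hfm i)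
  have hu : IsUnit (c i) := by
    by_contra h
    exact hi ((mem_maximalIdeal _).2 h)
  refine ⟨f ∘ i.succAbove, le_antisymm ?_ ?_⟩
  · rw [Ideal.span_le, Fin.range_cons]
    rintro _ (rfl | ⟨j, rfl⟩)
    · exact hx
    · exact hfm _
  · conv_lhs => rw [← hf]
    rw [Ideal.span_le]
    set J := Ideal.span (Set.range (Fin.cons x (f ∘ i.succAbove) : Fin (n + 1) → A))
    have hJ : ∀ j, f (i.succAbove j) ∈ J := fun j => Ideal.subset_span ⟨j.succ, by simp⟩
    have hxJ : x ∈ J := Ideal.subset_span ⟨0, by simp⟩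
    rintro _ ⟨j, rfl⟩
    rcases Fin.eq_self_or_eq_succAbove i j with rfl | ⟨j, rfl⟩
    · rw [Fin.sum_univ_succAbove _ j] at hc
      have : c j * f j ∈ J := by
        rw [← eq_sub_iff_add_eq] at hc
        rw [hc]
        exact J.sub_mem hxJ (Ideal.sum_mem _ fun k _ => J.mul_mem_left _ (hJ k))
      exact (Ideal.unit_mul_mem_iff_mem _ hu).1 this
    · exact hJ j

variable [IsNoetherianRing A]

lemma dim_le_of_gens {n : ℕ} (f : Fin n → A) (hf : Ideal.span (Set.range f) = maximalIdeal A) :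
    ringKrullDim A ≤ n := by
  refine (ringKrullDim_le_spanFinrank_maximalIdeal A).trans ?_
  rw [← hf]
  have h1 := Submodule.spanFinrank_span_le_ncard_of_finite (R := A) (Set.finite_range f)
  have h2 : (Set.range f).ncard ≤ n := by
    rw [← Set.image_univ]
    refine (Set.ncard_image_le Set.finite_univ).trans ?_
    simp [Set.ncard_univ]
  exact_mod_cast h1.trans h2

lemma dim_cancel {d : WithBot ℕ∞} {n : ℕ} (h1 : d ≤ n) (h2 : ((n + 1 : ℕ) : WithBot ℕ∞) ≤ d + 1) :
    d = n := by
  induction d with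
  | bot => simp at h2
  | coe d =>
    induction d with
    | top => 
      exact absurd h1 (not_le.2 (WithBot.coe_lt_coe.2 (ENat.natCast_lt_top n)))
    | coe d =>
      norm_cast at *
      omega

lemma dim_quot_ge {n : ℕ} (hdim : ringKrullDim A = (n + 1 : ℕ)) {x : A} (hx : x ∈ maximalIdeal A) :
    ((n + 1 : ℕ) : WithBot ℕ∞) ≤ ringKrullDim (A ⧸ Ideal.span {x}) + 1 := by
  rw [← hdim]
  have := ringKrullDim_le_ringKrullDim_add_card (R := A) (S := {x}) (by simpa using hx)
  rw [Finset.coe_singleton] at this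
  simpa using this

lemma dim_quot {n : ℕ} (hdim : ringKrullDim A = (n + 1 : ℕ)) {x : A} (g : Fin n → A)
    (h : Ideal.span (Set.range (Fin.cons x g : Fin (n + 1) → A)) = maximalIdeal A) :
    ringKrullDim (A ⧸ Ideal.span {x}) = n := by
  have hx : x ∈ maximalIdeal A := h ▸ Ideal.subset_span ⟨0, by simp⟩
  have := isLocal_quot hx
  exact dim_cancel (dim_le_of_gens _ (gens_quot g h)) (dim_quot_ge hdim hx)

lemma gens_iff_finrank {n : ℕ} (hdim : ringKrullDim A = n) :
    Module.finrank (ResidueField A) (CotangentSpace A) = n ↔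
      ∃ f : Fin n → A, Ideal.span (Set.range f) = maximalIdeal A := by
  rw [← spanFinrank_maximalIdeal_eq_finrank_cotangentSpace]
  constructor
  · intro h
    have hfg : (maximalIdeal A).FG := IsNoetherian.noetherian _
    obtain ⟨s, hs, hs2⟩ := Submodule.FG.exists_span_finset_card_eq_spanFinrank hfg
    rw [h] at hs
    refine ⟨fun i => (s.equivFinOfCardEq hs).symm i, ?_⟩
    rw [← hs2]
    congr 1
    ext a
    constructor
    · rintro ⟨i, rfl⟩
      exact Subtype.prop _
    · intro ha
      exact ⟨s.equivFinOfCardEq hs ⟨a, ha⟩, by simp⟩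
  · rintro ⟨f, hf⟩
    apply le_antisymm
    · rw [← hf]
      have h1 := Submodule.spanFinrank_span_le_ncard_of_finite (R := A) (Set.finite_range f)
      have h2 : (Set.range f).ncard ≤ n := by
        rw [← Set.image_univ]
        refine (Set.ncard_image_le Set.finite_univ).trans ?_
        simp [Set.ncard_univ]
      exact h1.trans h2
    · have := ringKrullDim_le_spanFinrank_maximalIdeal A
      rw [hdim] at this
      exact_mod_cast this

lemma max_eq_bot_of_sq (h : maximalIdeal A ≤ maximalIdeal A ^ 2) : maximalIdeal A = ⊥ := by
  apply Submodule.eq_bot_of_le_smul_of_le_jacobson_bot (maximalIdeal A) _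
    (IsNoetherian.noetherian _)
  · rw [pow_two] at h
    exact h
  · exact IsLocalRing.maximalIdeal_le_jacobson _

lemma avoid (S : Set (Ideal A)) (hS : S.Finite) (hp : ∀ p ∈ S, p.IsPrime)
    (hm : ∀ p ∈ S, ¬ maximalIdeal A ≤ p) (h2 : ¬ maximalIdeal A ≤ maximalIdeal A ^ 2) :
    ∃ x ∈ maximalIdeal A, x ∉ maximalIdeal A ^ 2 ∧ ∀ p ∈ S, x ∉ p := by
  by_contra! hcon
  classical
  have := (Ideal.subset_union_prime (s := insert (maximalIdeal A ^ 2) hS.toFinset) (f := id)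
    (maximalIdeal A ^ 2) (maximalIdeal A ^ 2) (by
      intro i hi h _
      simp only [Finset.mem_insert, h, false_or, Set.Finite.mem_toFinset] at hi
      exact hp i hi) (I := maximalIdeal A)).1 (by
      intro x hx
      by_cases hx2 : x ∈ maximalIdeal A ^ 2
      · simp only [Set.mem_iUnion]
        exact ⟨_, by simp, hx2⟩
      · obtain ⟨p, hpS, hxp⟩ := hcon x hx hx2
        simp only [Set.mem_iUnion]
        exact ⟨p, by simp [hpS], hxp⟩)
  obtain ⟨i, hi, h⟩ := this
  simp only [Finset.mem_insert, Set.Finite.mem_toFinset] at hi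
  rcases hi with rfl | hi
  · exact h2 h
  · exact hm i hi h

lemma max_ne_bot {n : ℕ} (hdim : ringKrullDim A = (n + 1 : ℕ)) : maximalIdeal A ≠ ⊥ := by
  intro h
  have hF : IsField A := isField_iff_maximalIdeal_eq.2 h
  have := ringKrullDim_eq_zero_of_isField hF
  rw [hdim] at this
  norm_cast at this

end elementary


lemma regular_isDomain (n : ℕ) : ∀ (A : Type u) [CommRing A] [IsNoetherianRing A] [IsLocalRing A]
    (_ : ringKrullDim A = n) (f : Fin n → A) (_ : Ideal.span (Set.range f) = maximalIdeal A),
    IsDomain A := by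
  induction n with
  | zero =>
    intro A _ _ _ hdim f hf
    have : maximalIdeal A = ⊥ := by
      rw [← hf]
      simp
    exact (isField_iff_maximalIdeal_eq.2 this).isDomain
  | succ n ih =>
    intro A _ _ _ hdim f hf
    obtain ⟨x, hx, hx2, hxp⟩ := avoid (A := A) (minimalPrimes A)
      (minimalPrimes.finite_of_isNoetherianRing A)
      (fun p hp => hp.1.1) (by
        intro p hp hle
        have hpm : maximalIdeal A ∈ minimalPrimes A := by
          have := (maximalIdeal.isMaximal A).eq_of_le hp.1.1.ne_top hle
          rw [this]
          exact hp
        have h0 : (maximalIdeal A).height = 0 := Ideal.height_eq_zero_iff.2 hpm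
        have := IsLocalRing.maximalIdeal_height_eq_ringKrullDim (R := A)
        rw [h0, hdim] at this
        norm_cast at this) (fun h => max_ne_bot hdim (max_eq_bot_of_sq h))
    obtain ⟨g, hg⟩ := exchange f hf hx hx2
    have := isLocal_quot hx
    have hD := ih (A ⧸ Ideal.span {x}) (dim_quot hdim g hg) _ (gens_quot g hg)
    have hprime : (Ideal.span {x}).IsPrime := (Ideal.Quotient.isDomain_iff_prime _).1 hD
    obtain ⟨p, hp, hpx⟩ := Ideal.exists_minimalPrimes_le (I := (⊥ : Ideal A)) (J := Ideal.span {x})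
      bot_le
    have hpp : p.IsPrime := hp.1.1
    have hpb : p = ⊥ := by
      apply Submodule.eq_bot_of_le_smul_of_le_jacobson_bot (maximalIdeal A) p
        (IsNoetherian.noetherian _) _ (IsLocalRing.maximalIdeal_le_jacobson _)
      intro a ha
      obtain ⟨b, rfl⟩ := Ideal.mem_span_singleton'.1 (hpx ha)
      rcases hpp.mem_or_mem ha with h | h
      · rw [mul_comm]
        exact Submodule.smul_mem_smul hx h
      · exact absurd h (hxp p hp)
    rw [hpb] at hpp
    exact IsDomain.of_bot_isPrime A

lemma regular_head {n : ℕ} {A : Type u} [CommRing A] [IsNoetherianRing A] [IsLocalRing A]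
    (hdim : ringKrullDim A = (n + 1 : ℕ)) (x : A) (g : Fin n → A)
    (hf : Ideal.span (Set.range (Fin.cons x g : Fin (n + 1) → A)) = maximalIdeal A) :
    IsSMulRegular A x := by
  have hD := regular_isDomain (n + 1) A hdim _ hf
  have hx : x ≠ 0 := by
    rintro rfl
    rw [Fin.range_cons, Ideal.span_insert_zero] at hf
    have := dim_le_of_gens g hf
    rw [hdim] at this
    norm_cast at this
    omega
  intro a b hab
  exact mul_left_cancel₀ hx hab


open scoped Pointwise in
lemma gens_weaklyRegular (n : ℕ) : ∀ (A : Type u) [CommRing A] [IsNoetherianRing A] [IsLocalRing A]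
    (_ : ringKrullDim A = n) (f : Fin n → A) (_ : Ideal.span (Set.range f) = maximalIdeal A),
    RingTheory.Sequence.IsWeaklyRegular A (List.ofFn f) := by
  induction n with
  | zero =>
    intro A _ _ _ hdim f hf
    rw [List.ofFn_zero]
    exact RingTheory.Sequence.IsWeaklyRegular.nil _ _
  | succ n ih =>
    intro A _ _ _ hdim f hf
    obtain ⟨x, g, rfl⟩ : ∃ x g, f = Fin.cons x g := ⟨f 0, Fin.tail f, (Fin.cons_self_tail f).symm⟩
    have hx : x ∈ maximalIdeal A := hf ▸ Ideal.subset_span ⟨0, by simp⟩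
    have := isLocal_quot hx
    rw [List.ofFn_succ]
    simp only [Fin.cons_zero, Fin.cons_succ]
    rw [RingTheory.Sequence.isWeaklyRegular_cons_iff']
    refine ⟨regular_head hdim x g hf, ?_⟩
    have h1 := ih (A ⧸ Ideal.span {x}) (dim_quot hdim g hf) _ (gens_quot g hf)
    rw [List.map_ofFn]
    have h2 : x • (⊤ : Submodule A A) = Ideal.span {x} := by
      rw [← Submodule.ideal_span_singleton_smul]
      simp
    let e := (Submodule.quotEquivOfEq _ _ h2).extendScalarsOfSurjective
      (Ideal.Quotient.mk_surjective (I := Ideal.span {x}))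
    exact (LinearEquiv.isWeaklyRegular_congr e _).2 h1

lemma projDim_residue (n : ℕ) (A : Type u) [CommRing A] [IsNoetherianRing A] [IsLocalRing A]
    (hdim : ringKrullDim A = n) (f : Fin n → A) (hf : Ideal.span (Set.range f) = maximalIdeal A) :
    projectiveDimension (ModuleCat.of A (A ⧸ maximalIdeal A)) = n := by
  have hl : Ideal.ofList (List.ofFn f) = maximalIdeal A := by
    rw [← hf]
    unfold Ideal.ofList
    congr 1
    ext a
    simp
  have h1 := gens_weaklyRegular n A hdim f hf
  have h2 := ModuleCat.projectiveDimension_quotient_eq_length.{u} (R := A) (List.ofFn f)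
    ⟨h1, by
      rw [hl, smul_eq_mul, Ideal.mul_top]
      exact (maximalIdeal.isMaximal A).ne_top.symm⟩
  rw [hl, List.length_ofFn] at h2
  rw [← h2]
  exact projectiveDimension_eq_of_iso (LinearEquiv.toModuleIso (Shrink.linearEquiv A _).symm)

lemma gldh_of_gens (n : ℕ) (A : Type u) [CommRing A] [IsNoetherianRing A] [IsLocalRing A]
    (hdim : ringKrullDim A = n) (f : Fin n → A) (hf : Ideal.span (Set.range f) = maximalIdeal A) :
    gldh A = n := by
  have hp := projDim_residue n A hdim f hf
  apply le_antisymm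
  · rw [gldh_le_iff]
    have h1 : HasProjectiveDimensionLT (ModuleCat.of A (A ⧸ maximalIdeal A)) (n + 1) := by
      change HasProjectiveDimensionLE _ n
      rw [← projectiveDimension_le_iff, hp]
    exact projDim_of_cyclic A n fun I => devissage A n h1 (A ⧸ I)
  · cases n with
    | zero => simp
    | succ n =>
      by_contra hcon
      rw [not_le] at hcon
      have h2 : gldh A ≤ n := by
        rw [Nat.cast_add, Nat.cast_one] at hcon
        exact Order.le_of_lt_add_one hcon
      rw [gldh_le_iff] at h2
      have h3 := h2 (ModuleCat.of A (A ⧸ maximalIdeal A))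
      change HasProjectiveDimensionLE _ n at h3
      rw [← projectiveDimension_le_iff, hp] at h3
      norm_cast at h3
      omega


lemma shortExact_mk {A : Type u} [CommRing A] {K F M : Type u} [AddCommGroup K] [Module A K]
    [AddCommGroup F] [Module A F] [AddCommGroup M] [Module A M] (ι : K →ₗ[A] F) (g : F →ₗ[A] M)
    (hι : Function.Injective ι) (e : Function.Exact ι g) (hg : Function.Surjective g) :
    (ShortComplex.mk (ModuleCat.ofHom ι) (ModuleCat.ofHom g)
      (ModuleCat.hom_ext (LinearMap.ext fun y => e.apply_apply_eq_zero y))).ShortExact := by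
  refine ShortComplex.ShortExact.mk' ?_ ((ModuleCat.mono_iff_injective _).2 hι)
    ((ModuleCat.epi_iff_surjective _).2 hg)
  exact (ShortComplex.ShortExact.moduleCat_exact_iff_function_exact _).2 e

lemma ring_pd (A : Type u) [CommRing A] (n : ℕ) :
    HasProjectiveDimensionLT (ModuleCat.of A A) (n + 1) := by
  have : Projective (ModuleCat.of A A) := by
    rw [← IsProjective.iff_projective]
    infer_instance
  rw [projective_iff_hasProjectiveDimensionLT_one] at this
  exact hasProjectiveDimensionLT_of_ge _ 1 _ (by omega)

lemma max_bot_of_ass (A : Type u) [CommRing A] [IsNoetherianRing A] [IsLocalRing A]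
    (hass : IsAssociatedPrime (maximalIdeal A) A) (N : ℕ)
    (h : HasProjectiveDimensionLT (ModuleCat.of A (A ⧸ maximalIdeal A)) (N + 1)) :
    maximalIdeal A = ⊥ := by
  obtain ⟨_, i, hi⟩ := (isAssociatedPrime_iff_exists_injective_linearMap _ _).1 hass
  induction N with
  | zero =>
    rw [zero_add, ← projective_iff_hasProjectiveDimensionLT_one, ← IsProjective.iff_projective] at h
    obtain ⟨s, hs⟩ := Module.projective_lifting_property (maximalIdeal A).mkQ LinearMap.id
      (Submodule.mkQ_surjective _)
    let e := s (Submodule.Quotient.mk 1)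
    have he : IsUnit e := by
      by_contra hne
      have h1 : (maximalIdeal A).mkQ e = Submodule.Quotient.mk 1 :=
        LinearMap.congr_fun hs (Submodule.Quotient.mk 1)
      have h2 : (maximalIdeal A).mkQ e = 0 :=
        (Submodule.Quotient.mk_eq_zero _).2 ((mem_maximalIdeal _).2 hne)
      rw [h2, eq_comm, Submodule.Quotient.mk_eq_zero] at h1
      exact (maximalIdeal.isMaximal A).ne_top ((Ideal.eq_top_iff_one _).2 h1)
    rw [eq_bot_iff]
    intro a ha
    have h3 : a • e = 0 := by
      rw [← map_smul, ← Submodule.Quotient.mk_smul, smul_eq_mul, mul_one,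
        (Submodule.Quotient.mk_eq_zero _).2 ha, map_zero]
    exact (he.mul_left_eq_zero).1 h3
  | succ N ih =>
    apply ih
    have hS := shortExact_mk i (LinearMap.range i).mkQ hi (LinearMap.exact_map_mkQ_range i)
      (Submodule.mkQ_surjective _)
    exact hS.hasProjectiveDimensionLT_X₁ (N + 1) (ring_pd A N)
      (devissage A (N + 1) h (A ⧸ LinearMap.range i))

lemma exists_compl (A : Type u) [CommRing A] [IsLocalRing A] {x : A} (hx : x ∈ maximalIdeal A)
    (hx2 : x ∉ maximalIdeal A ^ 2) :
    ∃ b : Submodule A (maximalIdeal A),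
      (∀ a : maximalIdeal A, ∃ c : A, ∃ y ∈ b, a = c • ⟨x, hx⟩ + y) ∧
      (∀ c : A, c • (⟨x, hx⟩ : maximalIdeal A) ∈ b → c ∈ maximalIdeal A) := by
  let xb : CotangentSpace A := (maximalIdeal A).toCotangent ⟨x, hx⟩
  have hxb : xb ≠ 0 := fun h => hx2 (((maximalIdeal A).toCotangent_eq_zero ⟨x, hx⟩).1 h)
  obtain ⟨W, hW⟩ := Submodule.exists_isCompl (Submodule.span (ResidueField A) {xb})
  have key : ∀ c : A, (maximalIdeal A).toCotangent (c • ⟨x, hx⟩) = residue A c • xb := by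
    intro c
    rw [map_smul]
    exact (algebraMap_smul (ResidueField A) c xb).symm
  refine ⟨(W.restrictScalars A).comap (maximalIdeal A).toCotangent, ?_, ?_⟩
  · intro a
    have : (maximalIdeal A).toCotangent a ∈ Submodule.span (ResidueField A) {xb} ⊔ W := by
      rw [hW.sup_eq_top]
      trivial
    obtain ⟨y, hy, z, hz, hyz⟩ := Submodule.mem_sup.1 this
    obtain ⟨c, rfl⟩ := Submodule.mem_span_singleton.1 hy
    obtain ⟨c, rfl⟩ := residue_surjective c
    refine ⟨c, a - c • ⟨x, hx⟩, ?_, by abel⟩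
    change (maximalIdeal A).toCotangent _ ∈ W
    rw [map_sub, key, ← hyz]
    simpa using hz
  · intro c hc
    change (maximalIdeal A).toCotangent _ ∈ W at hc
    rw [key] at hc
    have h0 := Submodule.disjoint_def.1 hW.disjoint _
      (Submodule.smul_mem _ _ (Submodule.mem_span_singleton_self xb)) hc
    rcases smul_eq_zero.1 h0 with h | h
    · exact (residue_eq_zero_iff c).1 h
    · exact absurd h hxb

open scoped Pointwise in
lemma exists_section (A : Type u) [CommRing A] [IsLocalRing A] {x : A} (hx : x ∈ maximalIdeal A)
    (hx2 : x ∉ maximalIdeal A ^ 2) [IsLocalRing (A ⧸ Ideal.span {x})] :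
    ∃ (p : QuotSMulTop x (maximalIdeal A) →ₗ[A ⧸ Ideal.span {x}] maximalIdeal (A ⧸ Ideal.span {x}))
      (s : maximalIdeal (A ⧸ Ideal.span {x}) →ₗ[A ⧸ Ideal.span {x}] QuotSMulTop x (maximalIdeal A)),
      p ∘ₗ s = LinearMap.id := by
  obtain ⟨b, hb1, hb2⟩ := exists_compl A hx hx2
  let p0 : maximalIdeal A →ₗ[A] maximalIdeal (A ⧸ Ideal.span {x}) :=
    { toFun := fun a => ⟨Ideal.Quotient.mk _ a.1, (comap_max_quot x _).2 a.2⟩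
      map_add' := fun a b => Subtype.ext (map_add _ _ _)
      map_smul' := fun a b => Subtype.ext (map_mul _ _ _) }
  have hp0x : ∀ c : A, p0 (c • ⟨x, hx⟩) = 0 := by
    intro c
    apply Subtype.ext
    change Ideal.Quotient.mk _ (c * x) = 0
    rw [Ideal.Quotient.eq_zero_iff_mem]
    exact Ideal.mul_mem_left _ _ (Ideal.mem_span_singleton_self x)
  have hker : x • (⊤ : Submodule A (maximalIdeal A)) ≤ LinearMap.ker p0 := by
    intro y hy
    obtain ⟨z, _, rfl⟩ := (Submodule.mem_smul_pointwise_iff_exists _ _ _).1 hy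
    have : x • z = z.1 • (⟨x, hx⟩ : maximalIdeal A) := Subtype.ext (mul_comm _ _)
    rw [this, LinearMap.mem_ker]
    exact hp0x _
  let p1 : QuotSMulTop x (maximalIdeal A) →ₗ[A] maximalIdeal (A ⧸ Ideal.span {x}) :=
    Submodule.liftQ _ p0 hker
  let q0 : maximalIdeal A →ₗ[A] QuotSMulTop x (maximalIdeal A) := Submodule.mkQ _
  have hp1 : ∀ y, p1 (q0 y) = p0 y := fun y => rfl
  let pb : b →ₗ[A] maximalIdeal (A ⧸ Ideal.span {x}) := p0 ∘ₗ b.subtype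
  let qb : b →ₗ[A] QuotSMulTop x (maximalIdeal A) := q0 ∘ₗ b.subtype
  have hpb : Function.Surjective pb := by
    rintro ⟨y, hy⟩
    obtain ⟨a, rfl⟩ := Ideal.Quotient.mk_surjective y
    rw [comap_max_quot] at hy
    obtain ⟨c, z, hz, hcz⟩ := hb1 ⟨a, hy⟩
    refine ⟨⟨z, hz⟩, ?_⟩
    have : p0 ⟨a, hy⟩ = p0 z := by
      rw [hcz, map_add, hp0x, zero_add]
    exact this.symm
  have hk : LinearMap.ker pb ≤ LinearMap.ker qb := by
    rintro ⟨y, hy⟩ h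
    rw [LinearMap.mem_ker] at h ⊢
    have h1 : Ideal.Quotient.mk (Ideal.span {x}) y.1 = 0 := congrArg Subtype.val h
    rw [Ideal.Quotient.eq_zero_iff_mem] at h1
    obtain ⟨c, hc⟩ := Ideal.mem_span_singleton'.1 h1
    have h2 : y = c • ⟨x, hx⟩ := Subtype.ext hc.symm
    have h3 := hb2 c (h2 ▸ hy)
    refine (Submodule.Quotient.mk_eq_zero _).2 ?_
    rw [Submodule.mem_smul_pointwise_iff_exists]
    refine ⟨⟨c, h3⟩, trivial, Subtype.ext ?_⟩
    change x * c = y.1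
    rw [← hc, mul_comm]
  let s1 : maximalIdeal (A ⧸ Ideal.span {x}) →ₗ[A] QuotSMulTop x (maximalIdeal A) :=
    (LinearMap.ker pb).liftQ qb hk ∘ₗ (pb.quotKerEquivOfSurjective hpb).symm.toLinearMap
  have hs1 : ∀ y : b, s1 (pb y) = qb y := by
    intro y
    have : (pb.quotKerEquivOfSurjective hpb).symm (pb y) = Submodule.Quotient.mk y := by
      rw [LinearEquiv.symm_apply_eq]
      rfl
    change (LinearMap.ker pb).liftQ qb hk ((pb.quotKerEquivOfSurjective hpb).symm (pb y)) = _
    rw [this]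
    rfl
  refine ⟨p1.extendScalarsOfSurjective Ideal.Quotient.mk_surjective,
    s1.extendScalarsOfSurjective Ideal.Quotient.mk_surjective, LinearMap.ext fun y => ?_⟩
  obtain ⟨y, rfl⟩ := hpb y
  change p1 (s1 (pb y)) = pb y
  rw [hs1]
  rfl

lemma gens_of_pd (n : ℕ) : ∀ (A : Type u) [CommRing A] [IsNoetherianRing A] [IsLocalRing A]
    (_ : ringKrullDim A = n) (N : ℕ)
    (_ : HasProjectiveDimensionLT (ModuleCat.of A (A ⧸ maximalIdeal A)) (N + 1)),
    ∃ f : Fin n → A, Ideal.span (Set.range f) = maximalIdeal A := by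
  induction n with
  | zero =>
    intro A _ _ _ hdim N h
    suffices hb : maximalIdeal A = ⊥ by
      exact ⟨Fin.elim0, by rw [hb]; simp⟩
    by_contra hb
    by_cases hass : IsAssociatedPrime (maximalIdeal A) A
    · exact hb (max_bot_of_ass A hass N h)
    · obtain ⟨x, hx, hx2, hxp⟩ := avoid (A := A) (associatedPrimes A A)
        (associatedPrimes.finite A A) (fun p hp => hp.1) (by
          intro p hp hle
          have := (maximalIdeal.isMaximal A).eq_of_le hp.1.ne_top hle
          rw [this] at hass
          exact hass hp) (fun h => hb (max_eq_bot_of_sq h))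
      have hreg : IsSMulRegular A x := by
        have h1 : x ∉ ⋃ p ∈ associatedPrimes A A, (p : Set A) := by
          simpa using hxp
        rw [biUnion_associatedPrimes_eq_compl_nonZeroDivisors] at h1
        have h2 : x ∈ nonZeroDivisors A := by simpa using h1
        intro a b hab
        exact (mul_cancel_left_mem_nonZeroDivisors h2).1 hab
      have hd := ringKrullDim_quotient_span_singleton_succ_eq_ringKrullDim hreg hx
      have := nontrivial_quot hx
      have h0 : (0 : WithBot ℕ∞) ≤ ringKrullDim (A ⧸ Ideal.span {x}) := ringKrullDim_nonneg_of_nontrivial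
      rw [hdim] at hd
      have : (0 : WithBot ℕ∞) + 1 ≤ ringKrullDim (A ⧸ Ideal.span {x}) + 1 := by gcongr
      rw [hd] at this
      norm_cast at this
  | succ n ih =>
    intro A _ _ _ hdim N h
    have hb := max_ne_bot hdim
    by_cases hass : IsAssociatedPrime (maximalIdeal A) A
    · exact absurd (max_bot_of_ass A hass N h) hb
    · obtain ⟨x, hx, hx2, hxp⟩ := avoid (A := A) (associatedPrimes A A)
        (associatedPrimes.finite A A) (fun p hp => hp.1) (by
          intro p hp hle
          have := (maximalIdeal.isMaximal A).eq_of_le hp.1.ne_top hle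
          rw [this] at hass
          exact hass hp) (fun h => hb (max_eq_bot_of_sq h))
      have hreg : IsSMulRegular A x := by
        have h1 : x ∉ ⋃ p ∈ associatedPrimes A A, (p : Set A) := by
          simpa using hxp
        rw [biUnion_associatedPrimes_eq_compl_nonZeroDivisors] at h1
        have h2 : x ∈ nonZeroDivisors A := by simpa using h1
        intro a b hab
        exact (mul_cancel_left_mem_nonZeroDivisors h2).1 hab
      have hloc := isLocal_quot hx
      have hd := ringKrullDim_quotient_span_singleton_succ_eq_ringKrullDim hreg hx
      have hd' : ringKrullDim (A ⧸ Ideal.span {x}) = n := by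
        rw [hdim] at hd
        generalize ringKrullDim (A ⧸ Ideal.span {x}) = d at hd
        induction d with
        | bot =>
          rw [WithBot.bot_add] at hd
          exact absurd hd (WithBot.bot_ne_coe (a := ((n + 1 : ℕ) : ℕ∞)))
        | coe d =>
          induction d with
          | top =>
            have h5 : (⊤ : ℕ∞) + 1 = ((n + 1 : ℕ) : ℕ∞) := WithBot.coe_injective hd
            rw [top_add] at h5
            exact absurd h5.symm (ENat.natCast_ne_top _)
          | coe d =>
            norm_cast at *
            omega
      have hm := devissage A N h (maximalIdeal A)
      have hmreg : IsSMulRegular (maximalIdeal A) x :=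
        hreg.of_injective (maximalIdeal A).subtype Subtype.val_injective
      have hq := projDim_quot A x hreg N (maximalIdeal A) hmreg hm
      obtain ⟨p, s, hps⟩ := exists_section A hx hx2
      let r : Retract (ModuleCat.of (A ⧸ Ideal.span {x}) (maximalIdeal (A ⧸ Ideal.span {x})))
          (ModuleCat.of (A ⧸ Ideal.span {x}) (QuotSMulTop x (maximalIdeal A))) :=
        { i := ModuleCat.ofHom s
          r := ModuleCat.ofHom p
          retract := ModuleCat.hom_ext hps }
      have hr := r.hasProjectiveDimensionLT (N + 1)
      have hS := shortExact_mk (maximalIdeal (A ⧸ Ideal.span {x})).subtype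
        (maximalIdeal (A ⧸ Ideal.span {x})).mkQ Subtype.val_injective
        (LinearMap.exact_subtype_mkQ _) (Submodule.mkQ_surjective _)
      have hk := hS.hasProjectiveDimensionLT_X₃ (N + 1) hr (ring_pd _ _)
      obtain ⟨g, hg⟩ := ih (A ⧸ Ideal.span {x}) hd' (N + 1) hk
      choose g' hg' using fun i => Ideal.Quotient.mk_surjective (g i)
      exact ⟨Fin.cons x g', gens_lift g' (by rw [← hg]; congr 2; ext i; exact hg' i)⟩

lemma gens_of_gldh (n : ℕ) (A : Type u) [CommRing A] [IsNoetherianRing A] [IsLocalRing A]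
    (hdim : ringKrullDim A = n) (h : gldh A ≠ ⊤) :
    ∃ f : Fin n → A, Ideal.span (Set.range f) = maximalIdeal A := by
  obtain ⟨N, hN⟩ := ENat.ne_top_iff_exists.1 h
  exact gens_of_pd n A hdim N ((gldh_le_iff A N).1 hN.ge _)


lemma decomp {R : Type*} [CommRing R] {n d : ℕ} (P : MvPolynomial (Fin (n + 1)) R)
    (hP : P.IsHomogeneous (d + 1)) :
    ∃ (P0 : MvPolynomial (Fin n) R) (P1 : MvPolynomial (Fin (n + 1)) R),
      P0.IsHomogeneous (d + 1) ∧ P1.IsHomogeneous d ∧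
      P = MvPolynomial.rename Fin.succ P0 + MvPolynomial.X 0 * P1 := by
  let φ : MvPolynomial (Fin (n + 1)) R →ₐ[R] MvPolynomial (Fin n) R :=
    MvPolynomial.aeval (Fin.cons 0 MvPolynomial.X)
  have hdvd : ∀ Q : MvPolynomial (Fin (n + 1)) R,
      MvPolynomial.X 0 ∣ Q - MvPolynomial.rename Fin.succ (φ Q) := by
    intro Q
    induction Q using MvPolynomial.induction_on with
    | C a => simp [φ]
    | add p q hp hq =>
      have : p + q - MvPolynomial.rename Fin.succ (φ (p + q)) =
        (p - MvPolynomial.rename Fin.succ (φ p)) + (q - MvPolynomial.rename Fin.succ (φ q)) := by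
        rw [map_add, map_add]
        ring
      rw [this]
      exact dvd_add hp hq
    | mul_X p i hp =>
      refine Fin.cases ?_ (fun i => ?_) i
      · simp [φ]
      · have : p * MvPolynomial.X i.succ -
            MvPolynomial.rename Fin.succ (φ (p * MvPolynomial.X i.succ)) =
          (p - MvPolynomial.rename Fin.succ (φ p)) * MvPolynomial.X i.succ := by
          rw [map_mul, map_mul]
          simp [φ]
          ring
        rw [this]
        exact Dvd.dvd.mul_right hp _
  have h0 : (φ P).IsHomogeneous (d + 1) := by
    have := hP.aeval (Fin.cons 0 MvPolynomial.X : Fin (n + 1) → MvPolynomial (Fin n) R) (n := 1)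
      (fun i => by
        refine Fin.cases ?_ (fun i => ?_) i
        · simpa using MvPolynomial.isHomogeneous_zero (Fin n) R 1
        · simpa using MvPolynomial.isHomogeneous_X R i)
    rwa [one_mul] at this
  obtain ⟨P1, hP1⟩ := hdvd P
  refine ⟨φ P, P1, h0, ?_, by rw [← hP1]; ring⟩
  have h1 : (MvPolynomial.X 0 * P1).IsHomogeneous (d + 1) := by
    rw [← hP1]
    exact hP.sub h0.rename_isHomogeneous
  intro s hs
  have h2 := h1 (d := Finsupp.single 0 1 + s) (by rwa [MvPolynomial.coeff_X_mul])
  rw [map_add] at h2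
  simp only [Finsupp.weight_single, Pi.one_apply, smul_eq_mul, mul_one] at h2
  omega

lemma eval_hom_mem {R : Type*} [CommRing R] (I : Ideal R) {n d : ℕ} (f : Fin n → R)
    (hf : ∀ i, f i ∈ I) (J : Ideal R) (P : MvPolynomial (Fin n) R) (hP : P.IsHomogeneous d)
    (hc : ∀ s, P.coeff s ∈ J) : MvPolynomial.eval f P ∈ J * I ^ d := by
  rw [MvPolynomial.eval_eq]
  refine Ideal.sum_mem _ fun s hs => Ideal.mul_mem_mul (hc s) ?_
  have h1 := hP (MvPolynomial.mem_support_iff.1 hs)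
  rw [← h1]
  have h2 : Finsupp.weight (1 : Fin n → ℕ) s = ∑ i ∈ s.support, s i := by
    rw [Finsupp.weight_apply, Finsupp.sum]
    simp
  rw [h2, ← Finset.prod_pow_eq_pow_sum]
  exact Ideal.prod_mem_prod fun i _ => Ideal.pow_mem_pow (hf i) _

lemma quasi_regular (n : ℕ) : ∀ (A : Type u) [CommRing A] [IsNoetherianRing A] [IsLocalRing A]
    (_ : ringKrullDim A = n) (f : Fin n → A) (_ : Ideal.span (Set.range f) = maximalIdeal A)
    (d : ℕ) (F : MvPolynomial (Fin n) A) (_ : F.IsHomogeneous d)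
    (_ : MvPolynomial.eval f F ∈ maximalIdeal A ^ (d + 1)), ∀ s, F.coeff s ∈ maximalIdeal A := by
  have hzero : ∀ (n : ℕ) (A : Type u) [CommRing A] [IsLocalRing A] (f : Fin n → A)
      (F : MvPolynomial (Fin n) A) (_ : F.IsHomogeneous 0)
      (_ : MvPolynomial.eval f F ∈ maximalIdeal A ^ (0 + 1)), ∀ s, F.coeff s ∈ maximalIdeal A := by
    intro n A _ _ f F hF h s
    have h1 : F = MvPolynomial.C (F.coeff 0) := by
      apply MvPolynomial.totalDegree_eq_zero_iff_eq_C.1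
      exact Nat.le_zero.1 hF.totalDegree_le
    rw [h1, MvPolynomial.eval_C, zero_add, pow_one] at h
    rw [h1, MvPolynomial.coeff_C]
    split_ifs
    · exact h
    · exact Ideal.zero_mem _
  induction n with
  | zero =>
    intro A _ _ _ hdim f hf d F hF h
    cases d with
    | zero => exact hzero 0 A f F hF h
    | succ d =>
      intro s
      by_contra hs
      have hs0 : F.coeff s ≠ 0 := fun h => hs (h ▸ Ideal.zero_mem _)
      have h1 := hF hs0
      have : s = 0 := Subsingleton.elim _ _
      rw [this, map_zero] at h1
      omega
  | succ n ih =>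
    intro A _ _ _ hdim f hf
    obtain ⟨x, g, rfl⟩ : ∃ x g, f = Fin.cons x g := ⟨f 0, Fin.tail f, (Fin.cons_self_tail f).symm⟩
    have hfm : ∀ i, (Fin.cons x g : Fin (n + 1) → A) i ∈ maximalIdeal A :=
      fun i => hf ▸ Ideal.subset_span ⟨i, rfl⟩
    have hx : x ∈ maximalIdeal A := hfm 0
    have hgm : ∀ i, g i ∈ maximalIdeal A := fun i => hfm i.succ
    have := isLocal_quot hx
    have hreg := regular_head hdim x g hf
    have ih' := ih (A ⧸ Ideal.span {x}) (dim_quot hdim g hf) _ (gens_quot g hf)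
    have hev : ∀ (P0 : MvPolynomial (Fin n) A) (P1 : MvPolynomial (Fin (n + 1)) A),
        MvPolynomial.eval (Fin.cons x g : Fin (n + 1) → A)
          (MvPolynomial.rename Fin.succ P0 + MvPolynomial.X 0 * P1) =
        MvPolynomial.eval g P0 + x * MvPolynomial.eval (Fin.cons x g : Fin (n + 1) → A) P1 := by
      intro P0 P1
      rw [map_add, map_mul, MvPolynomial.eval_rename, MvPolynomial.eval_X]
      rfl
    have hP0 : ∀ (d : ℕ) (P0 : MvPolynomial (Fin n) A) (_ : P0.IsHomogeneous d) (c : A)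
        (_ : MvPolynomial.eval g P0 + x * c ∈ maximalIdeal A ^ (d + 1)),
        MvPolynomial.eval g P0 ∈ maximalIdeal A ^ (d + 1) ∧ ∀ s, P0.coeff s ∈ maximalIdeal A := by
      intro d P0 h0 c h
      have h1 := ih' d (MvPolynomial.map (Ideal.Quotient.mk (Ideal.span {x})) P0) (h0.map _) (by
        rw [MvPolynomial.eval_map]
        have h2 := Ideal.mem_map_of_mem (Ideal.Quotient.mk (Ideal.span {x})) h
        rw [Ideal.map_pow, ← max_quot, map_add, map_mul,
          Ideal.Quotient.eq_zero_iff_mem.2 (Ideal.mem_span_singleton_self x), zero_mul, add_zero,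
          MvPolynomial.eval, MvPolynomial.coe_eval₂Hom, MvPolynomial.hom_eval₂, RingHom.comp_id] at h2
        exact h2)
      have h3 : ∀ s, P0.coeff s ∈ maximalIdeal A := by
        intro s
        have := h1 s
        rwa [MvPolynomial.coeff_map, comap_max_quot] at this
      refine ⟨?_, h3⟩
      rw [pow_succ']
      exact eval_hom_mem _ g hgm _ P0 h0 h3
    have hS : ∀ (e : ℕ) (a : A), x * a ∈ maximalIdeal A ^ (e + 1) →
        ∃ b ∈ maximalIdeal A ^ e, x * (a - b) ∈ maximalIdeal A ^ (e + 2) := by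
      intro e a ha
      have ha' := ha
      rw [← hf] at ha'
      obtain ⟨P, hP, hPe⟩ := (Ideal.mem_span_pow_iff_exists_isHomogeneous _ _).1 ha'
      obtain ⟨P0, P1, h0, h1, rfl⟩ := decomp P hP
      rw [hev] at hPe
      set b := MvPolynomial.eval (Fin.cons x g : Fin (n + 1) → A) P1 with hb
      have hg0 : MvPolynomial.eval g P0 = x * (a - b) := by
        rw [mul_sub, ← hPe]
        ring
      refine ⟨b, ?_, ?_⟩
      · have := eval_hom_mem (maximalIdeal A) _ hfm ⊤ P1 h1 (fun _ => trivial)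
        rwa [Ideal.top_mul] at this
      · rw [← hg0]
        refine (hP0 (e + 1) P0 h0 (b - a) ?_).1
        rw [hg0, ← mul_add]
        simp
    have hT : ∀ (e : ℕ) (a : A), x * a ∈ maximalIdeal A ^ (e + 1) → a ∈ maximalIdeal A ^ e := by
      intro e a ha
      have hj : ∀ j : ℕ, ∃ b ∈ maximalIdeal A ^ e, x * (a - b) ∈ maximalIdeal A ^ (e + j + 1) := by
        intro j
        induction j with
        | zero => exact ⟨0, Ideal.zero_mem _, by simpa using ha⟩
        | succ j ihj =>
          obtain ⟨b, hb, hb2⟩ := ihj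
          obtain ⟨c, hc, hc2⟩ := hS (e + j) (a - b) hb2
          refine ⟨b + c, Ideal.add_mem _ hb (Ideal.pow_le_pow_right (Nat.le_add_right e j) hc), ?_⟩
          rw [← sub_sub]
          exact hc2
      obtain ⟨k, hk⟩ := Ideal.exists_pow_inf_eq_pow_smul (maximalIdeal A) (Ideal.span {x})
      obtain ⟨b, hb, hb2⟩ := hj k
      have h1 : x * (a - b) ∈ maximalIdeal A ^ (e + k) • (⊤ : Submodule A A) ⊓ Ideal.span {x} := by
        refine ⟨?_, Ideal.mul_mem_right _ _ (Ideal.mem_span_singleton_self x)⟩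
        have h2 := Ideal.pow_le_pow_right (Nat.le_succ (e + k)) hb2
        simpa using h2
      rw [hk (e + k) (by omega), Nat.add_sub_cancel] at h1
      have h2 : x * (a - b) ∈ maximalIdeal A ^ e * Ideal.span {x} :=
        Submodule.smul_mono le_rfl inf_le_right h1
      obtain ⟨c, hc, hc2⟩ := Ideal.mem_mul_span_singleton.1 h2
      have h3 : c = a - b := hreg (by
        change x * c = x * (a - b)
        rw [← hc2, mul_comm])
      have : a = c + b := by rw [h3]; ring
      rw [this]
      exact Ideal.add_mem _ hc hb
    intro d
    induction d with
    | zero => exact hzero _ A _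
    | succ d ihd =>
      intro F hF h
      obtain ⟨P0, P1, h0, h1, rfl⟩ := decomp F hF
      rw [hev] at h
      obtain ⟨h2, h3⟩ := hP0 (d + 1) P0 h0 _ h
      have h4 := hT _ _ ((Ideal.add_mem_iff_right _ h2).1 h)
      have h5 := ihd P1 h1 h4
      intro s
      rw [MvPolynomial.coeff_add]
      refine Ideal.add_mem _ ?_ ?_
      · by_cases hs : ∃ t, Finsupp.mapDomain Fin.succ t = s
        · obtain ⟨t, rfl⟩ := hs
          rw [MvPolynomial.coeff_rename_mapDomain _ (Fin.succ_injective n)]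
          exact h3 t
        · rw [MvPolynomial.coeff_rename_eq_zero _ _ _ (fun t ht => absurd ⟨t, ht⟩ hs)]
          exact Ideal.zero_mem _
      · classical
        rw [MvPolynomial.coeff_X_mul']
        split_ifs
        · exact h5 _
        · exact Ideal.zero_mem _


section graded

variable {A : Type u} [CommRing A] [IsLocalRing A]

/-- The projection from the Rees algebra to the associated graded ring. -/
noncomputable def mkG (A : Type u) [CommRing A] [IsLocalRing A] :
    ↥(reesAlgebra (maximalIdeal A)) →+* AssocGraded A :=
  Ideal.Quotient.mk (Ideal.map (algebraMap A ↥(reesAlgebra (maximalIdeal A))) (maximalIdeal A))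

lemma mkG_surj : Function.Surjective (mkG A) := Ideal.Quotient.mk_surjective

lemma mkG_coeff (r : ↥(reesAlgebra (maximalIdeal A))) (h : mkG A r = 0) (i : ℕ) :
    (r : A[X]).coeff i ∈ maximalIdeal A ^ (i + 1) := by
  have h1 : r ∈ Ideal.map (algebraMap A ↥(reesAlgebra (maximalIdeal A))) (maximalIdeal A) :=
    Ideal.Quotient.eq_zero_iff_mem.1 h
  clear h
  revert i
  refine Submodule.span_induction ?_ ?_ ?_ ?_ h1
  · rintro _ ⟨a, ha, rfl⟩ i
    change (Polynomial.C a).coeff i ∈ _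
    rw [Polynomial.coeff_C]
    split_ifs with hi
    · subst hi
      simpa using ha
    · exact Ideal.zero_mem _
  · intro i
    simp
  · intro x y _ _ hx hy i
    simpa using Ideal.add_mem _ (hx i) (hy i)
  · intro a x _ hx i
    change ((a : A[X]) * (x : A[X])).coeff i ∈ _
    rw [Polynomial.coeff_mul]
    refine Ideal.sum_mem _ fun p hp => ?_
    have h2 := (mem_reesAlgebra_iff _ _).1 a.2 p.1
    have h3 := Ideal.mul_mem_mul h2 (hx p.2)
    rw [← pow_add, ← add_assoc, Finset.HasAntidiagonal.mem_antidiagonal.1 hp] at h3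
    exact h3

/-- Homogeneous element of the Rees algebra. -/
noncomputable def mono (i : ℕ) (a : A) (ha : a ∈ maximalIdeal A ^ i) :
    ↥(reesAlgebra (maximalIdeal A)) :=
  ⟨Polynomial.monomial i a, reesAlgebra.monomial_mem.2 ha⟩

lemma mem_piece (i : ℕ) (z : AssocGraded A) (hz : z ∈ AssocGraded.piece A i) :
    ∃ (a : A) (ha : a ∈ maximalIdeal A ^ i), z = mkG A (mono i a ha) := by
  refine Submodule.span_induction ?_ ?_ ?_ ?_ hz
  · rintro _ ⟨x, ⟨a, hx⟩, rfl⟩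
    have h1 := x.2
    rw [hx] at h1
    exact ⟨a, reesAlgebra.monomial_mem.1 h1, congrArg (mkG A) (Subtype.ext hx)⟩
  · refine ⟨0, Ideal.zero_mem _, ?_⟩
    rw [← map_zero (mkG A)]
    exact congrArg (mkG A) (Subtype.ext (by simp [mono]))
  · rintro _ _ _ _ ⟨a, ha, rfl⟩ ⟨b, hb, rfl⟩
    refine ⟨a + b, Ideal.add_mem _ ha hb, ?_⟩
    rw [← map_add]
    exact congrArg (mkG A) (Subtype.ext (by simp [mono]))
  · rintro c _ _ ⟨a, ha, rfl⟩
    obtain ⟨c, rfl⟩ := residue_surjective c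
    refine ⟨c * a, Ideal.mul_mem_left _ _ ha, ?_⟩
    rw [Algebra.smul_def]
    change mkG A (algebraMap A _ c) * mkG A _ = _
    rw [← map_mul]
    refine congrArg (mkG A) (Subtype.ext ?_)
    change Polynomial.C c * Polynomial.monomial i a = Polynomial.monomial i (c * a)
    rw [Polynomial.C_mul_monomial]

lemma mono_mem_piece (i : ℕ) (a : A) (ha : a ∈ maximalIdeal A ^ i) :
    mkG A (mono i a ha) ∈ AssocGraded.piece A i :=
  Submodule.subset_span ⟨mono i a ha, ⟨a, rfl⟩, rfl⟩

variable {n : ℕ} (f : Fin n → A) (hf : ∀ i, f i ∈ maximalIdeal A)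

/-- The evaluation map to the Rees algebra. -/
noncomputable def Psi : MvPolynomial (Fin n) A →ₐ[A] ↥(reesAlgebra (maximalIdeal A)) :=
  MvPolynomial.aeval fun i => mono 1 (f i) (by rw [pow_one]; exact hf i)

lemma Psi_hom {d : ℕ} (P : MvPolynomial (Fin n) A) (hP : P.IsHomogeneous d) :
    (Psi f hf P : A[X]) = Polynomial.monomial d (MvPolynomial.eval f P) := by
  have h1 : (Psi f hf P : A[X]) = MvPolynomial.aeval (fun i => Polynomial.monomial 1 (f i)) P := by
    have : ((reesAlgebra (maximalIdeal A)).val.comp (Psi f hf)) =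
        MvPolynomial.aeval (fun i => Polynomial.monomial 1 (f i)) := by
      apply MvPolynomial.algHom_ext
      intro i
      simp [Psi, mono]
    exact DFunLike.congr_fun this P
  rw [h1, MvPolynomial.aeval_def, MvPolynomial.eval₂_eq, MvPolynomial.eval_eq, map_sum]
  refine Finset.sum_congr rfl fun s hs => ?_
  have h2 := hP (MvPolynomial.mem_support_iff.1 hs)
  have h3 : Finsupp.weight (1 : Fin n → ℕ) s = ∑ i ∈ s.support, s i := by
    rw [Finsupp.weight_apply, Finsupp.sum]
    simp
  rw [h3] at h2
  have h4 : ∀ i, (Polynomial.monomial 1 (f i) : A[X]) = Polynomial.C (f i) * Polynomial.X := by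
    intro i
    rw [Polynomial.C_mul_X_eq_monomial]
  simp only [h4, mul_pow, Finset.prod_mul_distrib]
  rw [Finset.prod_pow_eq_pow_sum, h2, ← Polynomial.C_mul_X_pow_eq_monomial]
  simp only [map_mul, map_prod, map_pow, mul_assoc, Polynomial.algebraMap_eq]

lemma Psi_coeff (d : ℕ) (P : MvPolynomial (Fin n) A) :
    (Psi f hf P : A[X]).coeff d =
      MvPolynomial.eval f (MvPolynomial.homogeneousComponent d P) := by
  induction P using MvPolynomial.induction_on' with
  | monomial s a =>
    have hh : (MvPolynomial.monomial s a).IsHomogeneous s.degree :=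
      MvPolynomial.isHomogeneous_monomial a rfl
    rw [Psi_hom f hf _ hh, Polynomial.coeff_monomial,
      MvPolynomial.homogeneousComponent_of_mem hh]
    by_cases h : s.degree = d
    · subst h
      simp
    · rw [if_neg h, if_neg (Ne.symm h), map_zero]
  | add p q hp hq =>
    rw [map_add, map_add, map_add, ← hp, ← hq]
    simp

lemma Psi_comm (φ : MvPolynomial (Fin n) (ResidueField A) →ₐ[ResidueField A] AssocGraded A)
    (hφ : ∀ i, φ (MvPolynomial.X i) = mkG A (mono 1 (f i) (by rw [pow_one]; exact hf i)))
    (P : MvPolynomial (Fin n) A) :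
    φ (MvPolynomial.map (residue A) P) = mkG A (Psi f hf P) := by
  have : (φ : MvPolynomial (Fin n) (ResidueField A) →+* AssocGraded A).comp
      (MvPolynomial.map (residue A)) = (mkG A).comp (Psi f hf).toRingHom := by
    apply MvPolynomial.ringHom_ext
    · intro a
      have h1 : (Psi f hf) (MvPolynomial.C a) = algebraMap A _ a := (Psi f hf).commutes a
      have h2 : φ (MvPolynomial.C (residue A a)) = algebraMap _ _ (residue A a) := φ.commutes _
      change φ (MvPolynomial.map (residue A) (MvPolynomial.C a)) =
        mkG A ((Psi f hf) (MvPolynomial.C a))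
      rw [MvPolynomial.map_C, h1, h2]
      rfl
    · intro i
      change φ (MvPolynomial.map (residue A) (MvPolynomial.X i)) =
        mkG A ((Psi f hf) (MvPolynomial.X i))
      rw [MvPolynomial.map_X, hφ]
      simp [Psi]
  exact DFunLike.congr_fun this P

lemma lift_hom {d : ℕ} (F : MvPolynomial (Fin n) (ResidueField A)) (hF : F.IsHomogeneous d) :
    ∃ P : MvPolynomial (Fin n) A, P.IsHomogeneous d ∧ MvPolynomial.map (residue A) P = F := by
  obtain ⟨P, rfl⟩ := MvPolynomial.map_surjective (residue A) residue_surjective F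
  refine ⟨MvPolynomial.homogeneousComponent d P, MvPolynomial.homogeneousComponent_isHomogeneous _ _,
    ?_⟩
  ext s
  rw [MvPolynomial.coeff_map, MvPolynomial.coeff_homogeneousComponent, MvPolynomial.coeff_map]
  split_ifs with h
  · rfl
  · by_contra hne
    rw [map_zero] at hne
    have := hF (d := s) (by rw [MvPolynomial.coeff_map]; exact Ne.symm hne)
    apply h
    rw [← this, Finsupp.degree_eq_weight_one]
    rfl

lemma gens_of_graded [IsNoetherianRing A]
    (e : MvPolynomial (Fin n) (ResidueField A) ≃ₐ[ResidueField A] AssocGraded A)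
    (he : ∀ i : ℕ, Submodule.map e.toLinearMap
         (MvPolynomial.homogeneousSubmodule (Fin n) (ResidueField A) i) =
           AssocGraded.piece A i) :
    ∃ f : Fin n → A, Ideal.span (Set.range f) = maximalIdeal A := by
  have h1 : ∀ i : Fin n, ∃ (a : A) (ha : a ∈ maximalIdeal A ^ 1),
      e (MvPolynomial.X i) = mkG A (mono 1 a ha) := by
    intro i
    apply mem_piece
    rw [← he 1]
    exact ⟨MvPolynomial.X i, MvPolynomial.isHomogeneous_X _ i, rfl⟩
  choose f hf1 hf2 using h1
  have hf : ∀ i, f i ∈ maximalIdeal A := fun i => by simpa using hf1 i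
  have hcomm := Psi_comm f hf e.toAlgHom hf2
  have hle : Ideal.span (Set.range f) ≤ maximalIdeal A := by
    rw [Ideal.span_le]
    rintro _ ⟨i, rfl⟩
    exact hf i
  refine ⟨f, le_antisymm hle ?_⟩
  refine Submodule.le_of_le_smul_of_le_jacobson_bot (I := maximalIdeal A)
    (IsNoetherian.noetherian _) (IsLocalRing.maximalIdeal_le_jacobson _) ?_
  intro b hb
  have hb1 : b ∈ maximalIdeal A ^ 1 := by simpa using hb
  have h3 := mono_mem_piece 1 b hb1
  rw [← he 1] at h3
  obtain ⟨L, hL, hLb⟩ := h3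
  obtain ⟨P, hP, rfl⟩ := lift_hom L hL
  have h4 : mkG A (Psi f hf P) = mkG A (mono 1 b hb1) := by
    rw [← hcomm]
    exact hLb
  rw [← sub_eq_zero, ← map_sub] at h4
  have h5 := mkG_coeff _ h4 1
  have h6 : ((Psi f hf P - mono 1 b hb1 : ↥(reesAlgebra (maximalIdeal A))) : A[X]).coeff 1 =
      MvPolynomial.eval f P - b := by
    change ((Psi f hf P : A[X]) - Polynomial.monomial 1 b).coeff 1 = _
    rw [Psi_hom f hf P hP]
    simp
  rw [h6] at h5
  have h7 := eval_hom_mem (Ideal.span (Set.range f)) f (fun i => Ideal.subset_span ⟨i, rfl⟩) ⊤ P hP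
    (fun _ => trivial)
  rw [Ideal.top_mul, pow_one] at h7
  have h8 : b = MvPolynomial.eval f P + -(MvPolynomial.eval f P - b) := by ring
  rw [h8]
  refine Submodule.add_mem_sup h7 (Submodule.neg_mem _ ?_)
  rw [smul_eq_mul, ← pow_two]
  exact h5

lemma graded_of_gens [IsNoetherianRing A] (hdim : ringKrullDim A = n)
    (f : Fin n → A) (hfs : Ideal.span (Set.range f) = maximalIdeal A) :
    ∃ e : MvPolynomial (Fin n) (ResidueField A) ≃ₐ[ResidueField A] AssocGraded A,
       ∀ i : ℕ, Submodule.map e.toLinearMap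
         (MvPolynomial.homogeneousSubmodule (Fin n) (ResidueField A) i) =
           AssocGraded.piece A i := by
  have hf : ∀ i, f i ∈ maximalIdeal A := fun i => hfs ▸ Ideal.subset_span ⟨i, rfl⟩
  let φ : MvPolynomial (Fin n) (ResidueField A) →ₐ[ResidueField A] AssocGraded A :=
    MvPolynomial.aeval fun i => mkG A (mono 1 (f i) (by rw [pow_one]; exact hf i))
  have hcomm := Psi_comm f hf φ (fun i => by simp [φ])
  have hgen : ∀ (i : ℕ) (a : A), a ∈ maximalIdeal A ^ i → ∃ G : MvPolynomial (Fin n) A,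
      G.IsHomogeneous i ∧ MvPolynomial.eval f G = a := by
    intro i a ha
    rw [← hfs] at ha
    exact (Ideal.mem_span_pow_iff_exists_isHomogeneous _ _).1 ha
  have hinj : Function.Injective φ := by
    rw [injective_iff_map_eq_zero]
    intro F hF
    obtain ⟨P, rfl⟩ := MvPolynomial.map_surjective (residue A) residue_surjective F
    rw [hcomm] at hF
    have h1 : ∀ d s, (MvPolynomial.homogeneousComponent d P).coeff s ∈ maximalIdeal A := by
      intro d
      apply quasi_regular n A hdim f hfs d _ (MvPolynomial.homogeneousComponent_isHomogeneous _ _)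
      rw [← Psi_coeff f hf]
      exact mkG_coeff _ hF d
    ext s
    have h2 := h1 s.degree s
    rw [MvPolynomial.coeff_homogeneousComponent, if_pos rfl] at h2
    rw [MvPolynomial.coeff_map, MvPolynomial.coeff_zero]
    exact (residue_eq_zero_iff _).2 h2
  have hsurj : Function.Surjective φ := by
    intro z
    obtain ⟨r, rfl⟩ := mkG_surj z
    choose G hG1 hG2 using fun i => hgen i _ ((mem_reesAlgebra_iff _ _).1 r.2 i)
    refine ⟨MvPolynomial.map (residue A) (∑ i ∈ Finset.range ((r : A[X]).natDegree + 1), G i), ?_⟩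
    rw [hcomm]
    refine congrArg (mkG A) (Subtype.ext ?_)
    rw [map_sum, AddSubmonoidClass.coe_finsetSum]
    conv_rhs => rw [Polynomial.as_sum_range (r : A[X])]
    refine Finset.sum_congr rfl fun i _ => ?_
    rw [Psi_hom f hf _ (hG1 i), hG2]
  refine ⟨AlgEquiv.ofBijective φ ⟨hinj, hsurj⟩, fun i => le_antisymm ?_ ?_⟩
  · rintro _ ⟨F, hF, rfl⟩
    obtain ⟨P, hP, rfl⟩ := lift_hom F hF
    change φ _ ∈ _
    rw [hcomm]
    exact Submodule.subset_span ⟨Psi f hf P, ⟨_, Psi_hom f hf P hP⟩, rfl⟩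
  · intro z hz
    obtain ⟨a, ha, rfl⟩ := mem_piece i z hz
    obtain ⟨G, hG, rfl⟩ := hgen i a ha
    refine ⟨MvPolynomial.map (residue A) G, hG.map _, ?_⟩
    change φ _ = _
    rw [hcomm]
    exact congrArg (mkG A) (Subtype.ext (Psi_hom f hf G hG))

end graded

theorem serre_regularity_tfae
    (A : Type u) [CommRing A] [IsNoetherianRing A] [IsLocalRing A]
    (n : ℕ) (hdim : ringKrullDim A = n) :
    [gldh A ≠ ⊤,
     Module.finrank (ResidueField A) (CotangentSpace A) = n,
     ∃ f : Fin n → A, Ideal.span (Set.range f) = maximalIdeal A,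
     ∃ e : MvPolynomial (Fin n) (ResidueField A) ≃ₐ[ResidueField A] AssocGraded A,
       ∀ i : ℕ, Submodule.map e.toLinearMap
         (MvPolynomial.homogeneousSubmodule (Fin n) (ResidueField A) i) =
           AssocGraded.piece A i].TFAE ∧
    (gldh A ≠ ⊤ → gldh A = (n : ℕ∞)) := by
  refine ⟨?_, fun h => ?_⟩
  · tfae_have 1 → 3 := gens_of_gldh n A hdim
    tfae_have 3 → 1 := fun ⟨f, hf⟩ => by
      rw [gldh_of_gens n A hdim f hf]; exact ENat.coe_ne_top n
    tfae_have 2 ↔ 3 := gens_iff_finrank hdim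
    tfae_have 3 → 4 := fun ⟨f, hf⟩ => graded_of_gens hdim f hf
    tfae_have 4 → 3 := fun ⟨e, he⟩ => gens_of_graded e he
    tfae_finish
  · obtain ⟨f, hf⟩ := gens_of_gldh n A hdim h
    exact gldh_of_gens n A hdim f hf
end

section
/- Let (A, m) be a noetherian local ring of Krull dimension n ≥ 1 with finite global dimension, and let p ⊆ m be a prime ideal with dim A_p = n − 1 such that A_p is a regular local ring of dimension n − 1. Then the projective dimension of A/p over A is at least n − 1, and gldh A ≥ n. -/
/-!
STATEMENT 16: Let (A, m) be a noetherian local ring of Krull dimension n ≥ 1 with finite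
global dimension, and let p ⊆ m be a prime ideal with dim A_p = n − 1 such that A_p is a
regular local ring of dimension n − 1. Then the projective dimension of A/p over A is at
least n − 1, and gldh A ≥ n.
-/

open CategoryTheory Limits IsLocalRing

universe u

/-- The projective dimension of a module `M`: the supremum (in `ℕ∞`) over all modules `N`
of the integers `p` with `Ext_A^p(M, N) ≠ 0`. -/
noncomputable def pdim (A : Type u) [CommRing A] (M : ModuleCat.{u} A) : ℕ∞ :=
  sSup {n : ℕ∞ | ∃ (p : ℕ) (N : ModuleCat.{u} A),
    n = (p : ℕ∞) ∧ ¬ IsZero (((Ext A (ModuleCat.{u} A) p).obj (Opposite.op M)).obj N)}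


lemma aux_dim_le {B : Type u} [CommRing B] [IsNoetherianRing B] [IsLocalRing B] {d : ℕ}
    (f : Fin d → B) (hf : Ideal.span (Set.range f) = maximalIdeal B) :
    ringKrullDim B ≤ d := by
  refine (ringKrullDim_le_spanFinrank_maximalIdeal B).trans ?_
  rw [← hf]
  have h1 := Submodule.spanFinrank_span_le_ncard_of_finite (R := B) (Set.finite_range f)
  have h2 : (Set.range f).ncard ≤ d := by
    rw [← Set.image_univ]
    exact (Set.ncard_image_le (Set.finite_univ)).trans (by simp [Set.ncard_univ])
  exact_mod_cast h1.trans h2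

lemma aux_quot {B : Type u} [CommRing B] [IsNoetherianRing B] [IsLocalRing B] {d : ℕ}
    (hd : ringKrullDim B = (d + 1 : ℕ)) (x : B) (hx : x ∈ maximalIdeal B) (g : Fin d → B)
    (h : maximalIdeal B ≤ Ideal.span {x} ⊔ Ideal.span (Set.range g))
    (hg : ∀ i, g i ∈ maximalIdeal B) :
    ∃ _ : IsLocalRing (B ⧸ Ideal.span {x}), ringKrullDim (B ⧸ Ideal.span {x}) = d ∧
      Ideal.span (Set.range (Ideal.Quotient.mk (Ideal.span {x}) ∘ g)) =
        maximalIdeal (B ⧸ Ideal.span {x}) := by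
  have hle : Ideal.span {x} ≤ maximalIdeal B := by
    rw [Ideal.span_le]; simpa using hx
  have hnt : Nontrivial (B ⧸ Ideal.span {x}) := by
    apply Ideal.Quotient.nontrivial_iff.mpr
    intro h
    rw [h] at hle
    exact (maximalIdeal.isMaximal B).ne_top (top_le_iff.mp hle)
  have hl : IsLocalRing (B ⧸ Ideal.span {x}) :=
    IsLocalRing.of_surjective' (Ideal.Quotient.mk (Ideal.span {x})) Ideal.Quotient.mk_surjective
  refine ⟨hl, ?_⟩
  have hm : Ideal.span (Set.range (Ideal.Quotient.mk (Ideal.span {x}) ∘ g)) =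
        maximalIdeal (B ⧸ Ideal.span {x}) := by
    have hmap : (maximalIdeal B).map (Ideal.Quotient.mk (Ideal.span {x})) =
        maximalIdeal (B ⧸ Ideal.span {x}) := by
      apply le_antisymm
      · apply le_maximalIdeal
        intro htop
        have h2 := Ideal.comap_map_mk hle
        rw [htop, Ideal.comap_top] at h2
        exact (maximalIdeal.isMaximal B).ne_top h2.symm
      · intro y hy
        obtain ⟨y, rfl⟩ := Ideal.Quotient.mk_surjective y
        apply Ideal.mem_map_of_mem
        rw [mem_maximalIdeal, mem_nonunits_iff] at hy ⊢
        exact fun hu => hy (hu.map _)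
    rw [Set.range_comp, ← Ideal.map_span]
    apply le_antisymm
    · rw [← hmap]
      apply Ideal.map_mono
      rw [Ideal.span_le]
      rintro _ ⟨i, rfl⟩
      exact hg i
    · rw [← hmap]
      refine (Ideal.map_mono h).trans ?_
      rw [Ideal.map_sup, Ideal.map_quotient_self, bot_sup_eq]
  refine ⟨le_antisymm (aux_dim_le _ hm) ?_, hm⟩
  have h1 := ringKrullDim_le_ringKrullDim_quotient_add_card (R := B) ({x} : Finset B)
    (by simpa [IsLocalRing.ringJacobson_eq_maximalIdeal] using hx)
  rw [hd] at h1
  rw [Finset.coe_singleton, Finset.card_singleton] at h1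
  push_cast at h1
  exact (ENat.WithBot.add_le_add_one_right_iff).mp h1

lemma aux_domain (d : ℕ) : ∀ (B : Type u) [CommRing B] [IsNoetherianRing B] [IsLocalRing B]
    (f : Fin d → B) (_ : ringKrullDim B = d)
    (_ : Ideal.span (Set.range f) = maximalIdeal B), IsDomain B := by
  induction d with
  | zero =>
    intro B _ _ _ f hd hf
    have : maximalIdeal B = ⊥ := by
      rw [← hf]; simp [Set.range_eq_empty]
    exact (isField_iff_maximalIdeal_eq.mpr this).isDomain
  | succ d ih =>
    intro B _ _ _ f hd hf
    have hmin : ∀ q ∈ minimalPrimes B, ¬ maximalIdeal B ≤ q := by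
      intro q hq hle
      have : q.IsPrime := Ideal.IsMinimalPrime.isPrime hq
      have he : q = maximalIdeal B :=
        le_antisymm (le_maximalIdeal this.ne_top) hle
      have h0 : q.height = 0 := Ideal.height_eq_zero_iff.mpr hq
      have := maximalIdeal_height_eq_ringKrullDim (R := B)
      rw [← he, h0, hd] at this
      norm_cast at this
    have hsq : ¬ maximalIdeal B ≤ maximalIdeal B ^ 2 := by
      intro hle
      have hb : maximalIdeal B = ⊥ := by
        apply Submodule.eq_bot_of_le_smul_of_le_jacobson_bot (maximalIdeal B) _
          (IsNoetherian.noetherian _)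
        · rwa [pow_two] at hle
        · exact maximalIdeal_le_jacobson _
      obtain ⟨q, hq⟩ := (Ideal.nonempty_minimalPrimes (I := (⊥ : Ideal B)) bot_ne_top)
      exact hmin q hq (hb ▸ bot_le)
    obtain ⟨x, hx, hx2, hxm⟩ : ∃ x ∈ maximalIdeal B, x ∉ maximalIdeal B ^ 2 ∧
        ∀ q ∈ minimalPrimes B, x ∉ q := by
      by_contra! hcon
      have hfin : (insert (maximalIdeal B ^ 2) (minimalPrimes B)).Finite :=
        (minimalPrimes.finite_of_isNoetherianRing B).insert _
      have := (Ideal.subset_union_prime_finite hfin (f := id) (maximalIdeal B ^ 2)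
        (maximalIdeal B ^ 2) (I := maximalIdeal B) (by
          rintro i (rfl | hi) h1 _
          · exact absurd rfl h1
          · exact Ideal.IsMinimalPrime.isPrime hi)).mp (by
          intro x hx
          by_cases h : x ∈ maximalIdeal B ^ 2
          · exact Set.mem_biUnion (Set.mem_insert _ _) h
          · obtain ⟨q, hq, hxq⟩ := hcon x hx h
            exact Set.mem_biUnion (Set.mem_insert_of_mem _ hq) hxq)
      obtain ⟨i, (rfl | hi), hle⟩ := this
      · exact hsq hle
      · exact hmin i hi hle
    have hfm : ∀ i, f i ∈ maximalIdeal B := fun i => hf ▸ Ideal.subset_span ⟨i, rfl⟩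
    obtain ⟨c, hc⟩ := (Ideal.mem_span_range_iff_exists_fun).mp (hf ▸ hx)
    obtain ⟨i, hi⟩ : ∃ i, IsUnit (c i) := by
      by_contra! hcon
      apply hx2
      rw [← hc, pow_two]
      exact Ideal.sum_mem _ fun i _ => Ideal.mul_mem_mul ((mem_maximalIdeal _).mpr (hcon i)) (hfm i)
    have hle : maximalIdeal B ≤ Ideal.span {x} ⊔ Ideal.span (Set.range (f ∘ i.succAbove)) := by
      have hj : ∀ j, f (i.succAbove j) ∈
          Ideal.span {x} ⊔ Ideal.span (Set.range (f ∘ i.succAbove)) := fun j =>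
        Ideal.mem_sup_right (Ideal.subset_span ⟨j, rfl⟩)
      rw [← hf, Ideal.span_le]
      rintro _ ⟨j, rfl⟩
      by_cases hji : j = i
      · subst hji
        rw [Fin.sum_univ_succAbove _ j] at hc
        have h3 : c j * f j ∈ Ideal.span {x} ⊔ Ideal.span (Set.range (f ∘ j.succAbove)) := by
          rw [← eq_sub_iff_add_eq] at hc
          rw [hc]
          exact Ideal.sub_mem _ (Ideal.mem_sup_left (Ideal.mem_span_singleton_self x))
            (Ideal.sum_mem _ fun k _ => Ideal.mul_mem_left _ _ (hj k))
        exact (Ideal.unit_mul_mem_iff_mem _ hi).mp h3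
      · obtain ⟨k, rfl⟩ := Fin.exists_succAbove_eq hji
        exact hj k
    obtain ⟨hl, hd', hm'⟩ := aux_quot hd x hx _ hle (fun j => hfm _)
    have hdom := ih _ _ hd' hm'
    have hprime : (Ideal.span {x}).IsPrime := (Ideal.Quotient.isDomain_iff_prime _).mp hdom
    obtain ⟨q, hq, hqx⟩ := Ideal.exists_minimalPrimes_le (bot_le : ⊥ ≤ Ideal.span {x})
    have hqp : q.IsPrime := Ideal.IsMinimalPrime.isPrime hq
    have hxq := hxm q hq
    have hq0 : q = ⊥ := by
      apply Submodule.eq_bot_of_le_smul_of_le_jacobson_bot (maximalIdeal B) _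
          (IsNoetherian.noetherian _)
      · intro y hy
        obtain ⟨z, rfl⟩ := Ideal.mem_span_singleton'.mp (hqx hy)
        rw [mul_comm]
        exact Ideal.mul_mem_mul hx ((hqp.mem_or_mem hy).resolve_right hxq)
      · exact maximalIdeal_le_jacobson _
    rw [hq0] at hqp
    exact IsDomain.of_bot_isPrime B

open RingTheory.Sequence in
lemma aux_regular (d : ℕ) : ∀ (B : Type u) [CommRing B] [IsNoetherianRing B] [IsLocalRing B]
    (f : Fin d → B) (_ : ringKrullDim B = d)
    (_ : Ideal.span (Set.range f) = maximalIdeal B), IsWeaklyRegular B (List.ofFn f) := by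
  induction d with
  | zero => intro B _ _ _ f hd hf; simp
  | succ d ih =>
    intro B _ _ _ f hd hf
    have := aux_domain _ B f hd hf
    have hfm : ∀ i, f i ∈ maximalIdeal B := fun i => hf ▸ Ideal.subset_span ⟨i, rfl⟩
    have hle : maximalIdeal B ≤ Ideal.span {f 0} ⊔ Ideal.span (Set.range (f ∘ Fin.succ)) := by
      rw [← hf, Ideal.span_le]
      rintro _ ⟨j, rfl⟩
      refine Fin.cases ?_ (fun j => ?_) j
      · exact Ideal.mem_sup_left (Ideal.mem_span_singleton_self _)
      · exact Ideal.mem_sup_right (Ideal.subset_span ⟨j, rfl⟩)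
    have hne : f 0 ≠ 0 := by
      intro h0
      have h1 : ringKrullDim B ≤ d := by
        apply aux_dim_le (f ∘ Fin.succ)
        apply le_antisymm
        · rw [Ideal.span_le]
          rintro _ ⟨i, rfl⟩
          exact hfm _
        · simpa [h0] using hle
      rw [hd] at h1
      norm_cast at h1
      omega
    obtain ⟨hl, hd', hm'⟩ := aux_quot hd (f 0) (hfm 0) _ hle (fun j => hfm _)
    have hreg := ih _ _ hd' hm'
    rw [List.ofFn_succ, isWeaklyRegular_cons_iff]
    refine ⟨(IsSMulRegular.of_ne_zero hne), ?_⟩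
    have h2 : IsWeaklyRegular (B ⧸ Ideal.span {f 0}) (List.ofFn (f ∘ Fin.succ)) := by
      rw [← isWeaklyRegular_map_algebraMap_iff (B ⧸ Ideal.span {f 0})]
      rw [List.map_ofFn]
      exact hreg
    have e : (B ⧸ Ideal.span {f 0}) ≃ₗ[B] QuotSMulTop (f 0) B :=
      Submodule.quotEquivOfEq _ _ (by simp [← Submodule.ideal_span_singleton_smul])
    exact (e.isWeaklyRegular_congr _).mp h2


lemma aux_ext {A : Type u} [CommRing A] (M N : ModuleCat.{u} A) (k : ℕ)
    (h : IsZero (((Ext A (ModuleCat.{u} A) (k + 1)).obj (Opposite.op M)).obj N)) :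
    Subsingleton (Abelian.Ext M N (k + 1)) := by
  let P := ProjectiveResolution.of M
  have h1 := IsZero.of_iso h (P.isoExt (R := A) (k + 1) N).symm
  rw [← HomologicalComplex.exactAt_iff_isZero_homology,
    HomologicalComplex.exactAt_iff' _ k (k + 1) (k + 2) (by simp) (by simp),
    ShortComplex.ShortExact.moduleCat_exact_iff_function_exact] at h1
  apply subsingleton_of_forall_eq 0
  intro α
  obtain ⟨f, hf, rfl⟩ := P.extMk_surjective α (k + 2) rfl
  rw [P.extMk_eq_zero_iff f (k + 2) rfl hf k rfl]
  obtain ⟨g, hg⟩ := (h1 f).mp hf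
  exact ⟨g, hg⟩

lemma aux_pd {A : Type u} [CommRing A] (M : ModuleCat.{u} A) (k : ℕ) (hk : 1 ≤ k)
    (h : ∀ N, IsZero (((Ext A (ModuleCat.{u} A) k).obj (Opposite.op M)).obj N)) :
    HasProjectiveDimensionLT M k := by
  obtain ⟨k, rfl⟩ := Nat.exists_eq_add_of_le' hk
  exact hasProjectiveDimensionLT_of_enoughInjectives M _ fun N => aux_ext M N k (h N)

lemma aux_exists {A : Type u} [CommRing A] (M : ModuleCat.{u} A) (k : ℕ) (hk : 1 ≤ k)
    (h : (k : WithBot ℕ∞) ≤ projectiveDimension M) :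
    ∃ q : ℕ, k ≤ q ∧ ∃ N,
      ¬ IsZero (((Ext A (ModuleCat.{u} A) q).obj (Opposite.op M)).obj N) := by
  by_contra! hcon
  have := aux_pd M k hk (fun N => hcon k le_rfl N)
  rw [← projectiveDimension_lt_iff] at this
  exact absurd h (not_le.mpr this)

lemma aux_loc {A : Type u} [CommRing A] (p : Ideal A) [p.IsPrime] :
    projectiveDimension (ModuleCat.of (Localization.AtPrime p)
      (Localization.AtPrime p ⧸ maximalIdeal (Localization.AtPrime p))) ≤
    projectiveDimension (ModuleCat.of A (A ⧸ p)) := by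
  have h := ModuleCat.projectiveDimension_le_projectiveDimension_of_isLocalizedModule
    p.primeCompl (ModuleCat.of A (A ⧸ p))
  refine le_trans (le_of_eq ?_) h
  have hloc : IsLocalizedModule p.primeCompl
      ((ModuleCat.of A (A ⧸ p)).localizedModuleMkLinearMap p.primeCompl) :=
    ModuleCat.localizedModule_isLocalizedModule _ _
  have e1 := IsLocalizedModule.linearEquiv p.primeCompl
    (Submodule.toLocalizedQuotient' (Localization.AtPrime p) p.primeCompl
      (Algebra.linearMap A (Localization.AtPrime p)) p)
    ((ModuleCat.of A (A ⧸ p)).localizedModuleMkLinearMap p.primeCompl)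
  have e2 := LinearEquiv.extendScalarsOfIsLocalization p.primeCompl (Localization.AtPrime p) e1
  have hE : maximalIdeal (Localization.AtPrime p) = Submodule.localized' (Localization.AtPrime p) p.primeCompl
      (Algebra.linearMap A (Localization.AtPrime p)) p := by
    rw [Ideal.localized'_eq_map, Localization.AtPrime.map_eq_maximalIdeal]
  exact projectiveDimension_eq_of_iso ((Submodule.quotEquivOfEq _ _ hE).trans e2).toModuleIso

lemma aux_regpd {B : Type u} [CommRing B] [IsNoetherianRing B] [IsLocalRing B] {d : ℕ}
    (f : Fin d → B)
    (hf : Ideal.span (Set.range f) = maximalIdeal B)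
    (hreg : RingTheory.Sequence.IsWeaklyRegular B (List.ofFn f)) :
    projectiveDimension (ModuleCat.of B (B ⧸ maximalIdeal B)) = d := by
  have hfm : ∀ i, f i ∈ maximalIdeal B := fun i => hf ▸ Ideal.subset_span ⟨i, rfl⟩
  have hmem : ∀ r ∈ List.ofFn f, r ∈ maximalIdeal B := by
    intro r hr
    obtain ⟨i, rfl⟩ := List.mem_ofFn.mp hr
    exact hfm i
  have h := ModuleCat.projectiveDimension_quotient_eq_add_length_of_isWeaklyRegular
    (ModuleCat.of B B) (List.ofFn f) hreg hmem
  have h0 : projectiveDimension (ModuleCat.of B B) = 0 := by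
    have : Projective (ModuleCat.of B B) :=
      (IsProjective.iff_projective (R := B) B).mp inferInstance
    exact ModuleCat.projectiveDimension_eq_zero_of_projective _
  rw [h0, zero_add, List.length_ofFn] at h
  rw [← h]
  refine projectiveDimension_eq_of_iso (Submodule.quotEquivOfEq _ _ ?_).toModuleIso
  have : Ideal.ofList (List.ofFn f) = maximalIdeal B := by
    rw [← hf, Ideal.ofList]
    congr 1
    ext; simp [List.mem_ofFn]
  rw [this]
  simp

theorem pdim_quotient_prime_ge
    (A : Type u) [CommRing A] [IsNoetherianRing A] [IsLocalRing A]
    (n : ℕ) (hn : 1 ≤ n) (hdim : ringKrullDim A = n) (hgl : gldh A ≠ ⊤)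
    (p : Ideal A) [p.IsPrime] (hpm : p ≤ maximalIdeal A)
    (hdimp : ringKrullDim (Localization.AtPrime p) = (n - 1 : ℕ))
    (hregp : ∃ f : Fin (n - 1) → Localization.AtPrime p,
      Ideal.span (Set.range f) = maximalIdeal (Localization.AtPrime p)) :
    ((n - 1 : ℕ) : ℕ∞) ≤ pdim A (ModuleCat.of A (A ⧸ p)) ∧ (n : ℕ∞) ≤ gldh A := by
  have key : ((n - 1 : ℕ) : WithBot ℕ∞) ≤ projectiveDimension (ModuleCat.of A (A ⧸ p)) := by
    obtain ⟨f, hf⟩ := hregp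
    have : IsNoetherianRing (Localization.AtPrime p) :=
      IsLocalization.isNoetherianRing p.primeCompl _ inferInstance
    rw [← aux_regpd f hf (aux_regular _ _ f hdimp hf)]
    exact aux_loc p
  constructor
  · rcases Nat.eq_zero_or_pos (n - 1) with h0 | hpos
    · simp [h0]
    · obtain ⟨q, hq, N, hN⟩ := aux_exists _ _ hpos key
      exact le_trans (by exact_mod_cast hq) (le_sSup ⟨q, N, rfl, hN⟩)
  · have hne : p ≠ maximalIdeal A := by
      intro he
      have h1 := IsLocalization.AtPrime.ringKrullDim_eq_height p (Localization.AtPrime p)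
      have h2 := maximalIdeal_height_eq_ringKrullDim (R := A)
      rw [← he, ← h1, hdimp, hdim] at h2
      norm_cast at h2
      omega
    obtain ⟨x, hxm, hxp⟩ := SetLike.exists_of_lt (lt_of_le_of_ne hpm hne)
    have hreg : IsSMulRegular (ModuleCat.of A (A ⧸ p)) x := by
      rw [isSMulRegular_iff_right_eq_zero_of_smul]
      intro y hy
      obtain ⟨y, rfl⟩ := Ideal.Quotient.mk_surjective y
      have h3 : Ideal.Quotient.mk p (x * y) = 0 := hy
      rw [Ideal.Quotient.eq_zero_iff_mem] at h3
      exact Ideal.Quotient.eq_zero_iff_mem.mpr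
        ((Ideal.IsPrime.mem_or_mem inferInstance h3).resolve_left hxp)
    have hfin : Module.Finite A (ModuleCat.of A (A ⧸ p)) :=
      inferInstanceAs (Module.Finite A (A ⧸ p))
    have h4 := ModuleCat.projectiveDimension_quotSMulTop_eq_succ_of_isSMulRegular _ x hreg hxm
    have h5 : (n : WithBot ℕ∞) ≤ projectiveDimension
        (ModuleCat.of A (QuotSMulTop x (ModuleCat.of A (A ⧸ p)))) := by
      rw [h4]
      refine le_trans (le_of_eq ?_) (add_le_add_left key 1)
      obtain ⟨m, rfl⟩ := Nat.exists_eq_add_of_le' hn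
      simp
    obtain ⟨q, hq, N, hN⟩ := aux_exists _ _ hn h5
    exact le_trans (by exact_mod_cast hq) (le_sSup ⟨q, _, N, rfl, hN⟩)
end
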